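/- (Byun's formula for even intrusions, a = 2p.) Let p, b, c, d be nonnegative integers with d ≤ min(b, c). Then E(2p, b, c, d, p) = M(2p, b, c) · ∏_{k=1}^{d} 4^p · (1+b−k)_p · (1+c−k)_p · (k−1/2)_p / ( (2+b+c−2k)_{2p} · (k)_p ), where (x)_n denotes the Pochhammer symbol (rising factorial) over ℚ. -/

import Mathlib

open Finset

noncomputable section

/-- Binomial coefficient with integer arguments, equal to `0` whenever `k < 0` or `k > n`. -/
def ibinom (n k : ℤ) : ℚ :=
  if 0 ≤ k ∧ k ≤ n then (n.toNat.choose k.toNat : ℚ) else 0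

/-- The Pochhammer symbol (rising factorial) `x (x+1) ⋯ (x+n-1)`. -/
def poch (x : ℚ) (n : ℕ) : ℚ := (ascPochhammer ℚ n).eval x

/-- MacMahon's product `M(a,b,c)`. -/
def macmahon (a b c : ℕ) : ℚ :=
  ∏ i ∈ Finset.range a,
    ((Nat.factorial i : ℚ) * (Nat.factorial (b + c + i) : ℚ)) /
      ((Nat.factorial (b + i) : ℚ) * (Nat.factorial (c + i) : ℚ))

/-- The matrix `Q(a,b,c,d,p)` (with `1`-based indices `i, j ∈ {1, …, a+d}`):
rows/columns with index `≤ a` are lateral, the rest are intrusive. -/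
def Qmat (a b c d : ℕ) (p : ℤ) : Matrix (Fin (a + d)) (Fin (a + d)) ℚ :=
  Matrix.of fun i j =>
    if (i : ℕ) < a then
      if (j : ℕ) < a then
        ibinom ((b : ℤ) + c) ((c : ℤ) - (((i : ℕ) : ℤ) + 1) + (((j : ℕ) : ℤ) + 1))
      else
        ibinom (2 * (((j : ℕ) : ℤ) - a + 1) - 1)
          ((((j : ℕ) : ℤ) - a + 1) - (((i : ℕ) : ℤ) + 1) + p)
    else
      if (j : ℕ) < a then
        ibinom ((b : ℤ) + c - 2 * (((i : ℕ) : ℤ) - a + 1) + 1)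
          ((c : ℤ) - (((i : ℕ) : ℤ) - a + 1) + (((j : ℕ) : ℤ) + 1) - p)
      else
        ibinom (2 * (((j : ℕ) : ℤ) - ((i : ℕ) : ℤ))) (((j : ℕ) : ℤ) - ((i : ℕ) : ℤ))

/-- `E(a,b,c,d,p) = det Q(a,b,c,d,p)`, the signed count of lozenge tilings of the
`(a,b,c)`-hexagon with an even intrusion of length `d` at position `p`. -/
def E (a b c d : ℕ) (p : ℤ) : ℚ := (Qmat a b c d p).det

section Helpers

open Polynomial

/-- generalized binomial coefficient -/
def gb (y : ℤ) (k : ℕ) : ℚ := ((Ring.choose y k : ℤ) : ℚ)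

lemma gb_zero (y : ℤ) : gb y 0 = 1 := by simp [gb]

lemma gb_succ (y : ℤ) (k : ℕ) : gb (y + 1) (k + 1) = gb y k + gb y (k + 1) := by
  simp [gb, Ring.choose_succ_succ]

lemma gb_nat (n k : ℕ) : gb (n : ℤ) k = (n.choose k : ℚ) := by
  simp [gb, Ring.choose_natCast]

lemma ibinom_nat (n k : ℕ) : ibinom (n : ℤ) (k : ℤ) = (n.choose k : ℚ) := by
  unfold ibinom
  split_ifs with h
  · simp
  · rw [Nat.choose_eq_zero_of_lt (by omega)]; simp

lemma ibinom_neg (n k : ℤ) (hk : k < 0) : ibinom n k = 0 := by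
  unfold ibinom
  rw [if_neg (by omega)]

lemma ibinom_gt (n k : ℤ) (hk : n < k) : ibinom n k = 0 := by
  unfold ibinom
  rw [if_neg (by omega)]

lemma ibinom_gb (n : ℤ) (hn : 0 ≤ n) (k : ℕ) : ibinom n (k : ℤ) = gb n k := by
  obtain ⟨n, rfl⟩ := Int.eq_ofNat_of_zero_le hn
  rw [ibinom_nat, gb_nat]

lemma ibinom_symm (n k : ℤ) : ibinom n (n - k) = ibinom n k := by
  unfold ibinom
  by_cases h : 0 ≤ k ∧ k ≤ n
  · rw [if_pos h, if_pos (by omega)]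
    have : (n - k).toNat = n.toNat - k.toNat := by omega
    rw [this, Nat.choose_symm (by omega)]
  · rw [if_neg h, if_neg (by omega)]

lemma ibinom_pascal (n k : ℤ) (hn : 0 ≤ n) :
    ibinom (n + 1) k = ibinom n k + ibinom n (k - 1) := by
  obtain ⟨n, rfl⟩ := Int.eq_ofNat_of_zero_le hn
  rcases lt_trichotomy k 0 with hk | rfl | hk
  · rw [ibinom_neg _ _ hk, ibinom_neg _ _ hk, ibinom_neg _ _ (by omega)]; simp
  · rw [ibinom_neg _ (0 - 1) (by omega)]
    have := ibinom_nat (n + 1) 0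
    have h2 := ibinom_nat n 0
    push_cast at *
    rw [this, h2]; simp
  · obtain ⟨k, rfl⟩ : ∃ k' : ℕ, k = ((k' + 1 : ℕ) : ℤ) := ⟨(k - 1).toNat, by omega⟩
    have : (((k + 1 : ℕ) : ℤ) - 1) = (k : ℤ) := by push_cast; ring
    rw [this, ibinom_nat, ibinom_nat]
    have h2 := ibinom_nat (n + 1) (k + 1)
    push_cast at h2 ⊢
    rw [h2, Nat.choose_succ_succ]; push_cast; ring

/-- ballot numbers -/
def bal (x : ℕ) : ℕ → ℚ
  | 0 => 1
  | (k + 1) => ((x + 2 * k + 1).choose (k + 1) : ℚ) - ((x + 2 * k + 1).choose k : ℚ)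

lemma bal_zero_succ (k : ℕ) : bal 0 (k + 1) = 0 := by
  have : (2 * k + 1).choose (k + 1) = (2 * k + 1).choose k := by
    rw [← Nat.choose_symm_of_eq_add]; omega
  simp [bal, this]

lemma bal_rec (x k : ℕ) : bal (x + 1) (k + 1) = bal x (k + 1) + bal (x + 2) k := by
  cases k with
  | zero => simp [bal]
  | succ k =>
    simp only [bal]
    have e1 : x + 1 + 2 * (k + 1) + 1 = (x + 2 * k + 3) + 1 := by ring
    have e2 : x + 2 * (k + 1) + 1 = x + 2 * k + 3 := by ring
    have e3 : x + 2 + 2 * k + 1 = x + 2 * k + 3 := by ring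
    rw [e1, e2, e3, Nat.choose_succ_succ' (x + 2 * k + 3) (k + 1), Nat.choose_succ_succ' (x + 2 * k + 3) k]
    push_cast; ring

/-- Rothe--Hagen -/
lemma rothe_hagen (m : ℕ) : ∀ (x : ℕ) (y : ℤ),
    ∑ k ∈ range (m + 1), bal x k * gb (y - 2 * k) (m - k) = gb (x + y) m := by
  induction m with
  | zero => intro x y; simp [bal, gb_zero]
  | succ m ih =>
    intro x
    induction x with
    | zero =>
      intro y
      rw [Finset.sum_range_succ']
      simp only [bal_zero_succ]
      simp [bal]
    | succ x ihx =>
      intro y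
      have h1 := ihx y
      have h2 := ih (x + 2) (y - 2)
      rw [Finset.sum_range_succ'] at h1 ⊢
      simp only [bal_rec, add_mul, Finset.sum_add_distrib]
      have e : ((x + 1 : ℕ) : ℤ) + y = ((x : ℤ) + y) + 1 := by push_cast; ring
      rw [e, gb_succ, ← h1]
      have e2 : ((x + 2 : ℕ) : ℤ) + (y - 2) = (x : ℤ) + y := by push_cast; ring
      rw [e2] at h2
      rw [← h2]
      have h3 : ∀ k : ℕ, gb (y - 2 * ((k + 1 : ℕ) : ℤ)) (m + 1 - (k + 1)) =
          gb (y - 2 - 2 * (k : ℤ)) (m - k) := by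
        intro k
        congr 1
        · push_cast; ring
        · omega
      simp only [h3, bal]
      ring

/-- the coefficients `β` -/
def bet (r k : ℕ) : ℚ := if r ≤ k then bal (2 * r + 1) (k - r) else 0

lemma bet_full (n : ℤ) (hn : 0 ≤ n) (r μ : ℕ) :
    ibinom n ((μ : ℤ) - r) =
      ∑ k ∈ range (μ + 1), bet r k * gb (n - 2 * k - 1) (μ - k) := by
  by_cases h : r ≤ μ
  · obtain ⟨m, rfl⟩ := Nat.exists_eq_add_of_le h
    have e : ((r + m : ℕ) : ℤ) - r = (m : ℤ) := by push_cast; ring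
    rw [e, ibinom_gb _ hn]
    have h1 := rothe_hagen m (2 * r + 1) (n - 2 * r - 1)
    have e1 : ((2 * r + 1 : ℕ) : ℤ) + (n - 2 * r - 1) = n := by push_cast; ring
    rw [e1] at h1
    rw [← h1, show r + m + 1 = r + (m + 1) by ring, Finset.sum_range_add _ r]
    rw [Finset.sum_eq_zero (s := range r)]
    · rw [zero_add]
      refine Finset.sum_congr rfl fun k _ => ?_
      unfold bet
      rw [if_pos (by omega)]
      congr 2
      · omega
      · push_cast; ring
      · omega
    · intro k hk
      have := Finset.mem_range.1 hk
      simp [bet, show ¬ r ≤ k by omega]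
  · rw [ibinom_neg _ _ (by omega)]
    symm
    refine Finset.sum_eq_zero fun k hk => ?_
    have := Finset.mem_range.1 hk
    simp [bet, show ¬ r ≤ k by omega]

lemma bet_van (n : ℤ) (d r : ℕ) (μ : ℤ) (hμ : μ < d) (hn : 2 * (d : ℤ) ≤ n) :
    ibinom n (μ - r) = ∑ k ∈ range d, bet r k * ibinom (n - 2 * k - 1) (μ - k) := by
  by_cases h : 0 ≤ μ
  · obtain ⟨μ, rfl⟩ := Int.eq_ofNat_of_zero_le h
    rw [bet_full n (by omega)]
    have hs : range (μ + 1) ⊆ range d := by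
      intro x hx; rw [Finset.mem_range] at *; omega
    rw [← Finset.sum_subset hs]
    · refine Finset.sum_congr rfl fun k hk => ?_
      have := Finset.mem_range.1 hk
      rw [← ibinom_gb _ (by omega)]
      congr 2; omega
    · intro k _ hk
      rw [ibinom_neg _ _ (by rw [Finset.mem_range] at hk; omega), mul_zero]
  · rw [ibinom_neg _ _ (by omega)]
    symm
    refine Finset.sum_eq_zero fun k hk => ?_
    rw [ibinom_neg _ _ (by omega), mul_zero]

lemma bet_tail (n : ℤ) (d r l : ℕ) (hn : 2 * (d : ℤ) ≤ n) :
    ibinom n (((d + l : ℕ) : ℤ) - r) -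
      ∑ k ∈ range d, bet r k * ibinom (n - 2 * k - 1) (((d + l : ℕ) : ℤ) - k) =
    ∑ t ∈ range (l + 1), bet r (d + t) * gb (n - 2 * d - 1 - 2 * t) (l - t) := by
  rw [bet_full n (by omega), add_assoc, Finset.sum_range_add, add_comm, sub_eq_iff_eq_add]
  congr 1
  · refine Finset.sum_congr rfl fun k hk => ?_
    congr 2
    · push_cast; ring
    · omega
  · refine Finset.sum_congr rfl fun k hk => ?_
    have := Finset.mem_range.1 hk
    rw [← ibinom_gb _ (by omega)]
    congr 2; omega

lemma bet_D (d j r : ℕ) (hj : j < d) :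
    ibinom (2 * (j : ℤ) + 1) ((j : ℤ) - r) =
      ∑ k ∈ range d, bet r k * ibinom (2 * ((j : ℤ) - k)) ((j : ℤ) - k) := by
  rw [bet_full _ (by omega)]
  have hs : range (j + 1) ⊆ range d := by
    intro x hx; rw [Finset.mem_range] at *; omega
  rw [← Finset.sum_subset hs]
  · refine Finset.sum_congr rfl fun k hk => ?_
    have := Finset.mem_range.1 hk
    rw [← ibinom_gb _ (by omega)]
    congr 2
    · ring
    · omega
  · intro k _ hk
    rw [ibinom_neg _ _ (by rw [Finset.mem_range] at hk; omega), mul_zero]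

/-- row/column number of an index -/
def idx (p : ℕ) : Fin p ⊕ Fin p → ℕ := Sum.elim (fun r => p - 1 - r) (fun r => p + r)

/-- distance to the centre of an index -/
def rr (p : ℕ) : Fin p ⊕ Fin p → ℕ := Sum.elim (fun r => r) (fun r => r)

/-- the enumeration of the lateral indices -/
def eqv (p : ℕ) : Fin p ⊕ Fin p ≃ Fin (2 * p) :=
  ((Equiv.sumCongr Fin.revPerm (Equiv.refl (Fin p))).trans finSumFinEquiv).trans
    (finCongr (two_mul p).symm)

lemma eqv_val (p : ℕ) (x : Fin p ⊕ Fin p) : (eqv p x : ℕ) = idx p x := by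
  rcases x with r | r
  · simp [eqv, idx]; omega
  · simp [eqv, idx]; omega

lemma idx_lt (p : ℕ) (x : Fin p ⊕ Fin p) : idx p x < 2 * p := by
  rw [← eqv_val]; exact (eqv p x).2

/-- the Schur complement -/
def Smat (p : ℕ) (n c : ℤ) (d : ℕ) : Matrix (Fin p ⊕ Fin p) (Fin p ⊕ Fin p) ℚ :=
  Matrix.of fun x y => ibinom n (c - idx p x + idx p y) -
    ∑ k ∈ range d, bet (rr p x) k * ibinom (n - 2 * k - 1) (c - k + idx p y - p)

/-- the block enumeration -/
def eqv2 (p d : ℕ) : (Fin p ⊕ Fin p) ⊕ Fin d ≃ Fin (2 * p + d) :=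
  (Equiv.sumCongr (eqv p) (Equiv.refl (Fin d))).trans finSumFinEquiv

lemma eqv2_inl (p d : ℕ) (x : Fin p ⊕ Fin p) : (eqv2 p d (Sum.inl x) : ℕ) = idx p x := by
  simp [eqv2, eqv_val]

lemma eqv2_inr (p d : ℕ) (x : Fin d) : (eqv2 p d (Sum.inr x) : ℕ) = 2 * p + x := by
  simp [eqv2]

lemma B_entry (p d : ℕ) (x : Fin p ⊕ Fin p) (j : Fin d) :
    ibinom (2 * (((2 * p + j : ℕ) : ℤ) - (2 * p : ℕ) + 1) - 1)
          ((((2 * p + j : ℕ) : ℤ) - (2 * p : ℕ) + 1) - ((idx p x : ℤ) + 1) + p) =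
    ibinom (2 * (j : ℤ) + 1) ((j : ℤ) - rr p x) := by
  rcases x with r | r
  · rw [← ibinom_symm (2 * (j : ℤ) + 1)]
    congr 1
    · push_cast; ring
    · have := r.2
      simp only [idx, rr, Sum.elim_inl]
      omega
  · congr 1
    · push_cast; ring
    · simp only [idx, rr, Sum.elim_inr]
      omega

lemma E_eq (p b c d : ℕ) :
    E (2 * p) b c d (p : ℤ) = (Smat p ((b : ℤ) + c) c d).det := by
  classical
  let β : Matrix (Fin p ⊕ Fin p) (Fin d) ℚ := Matrix.of fun x k => bet (rr p x) k
  let Cm : Matrix (Fin d) (Fin p ⊕ Fin p) ℚ := Matrix.of fun k y =>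
    ibinom (((b : ℤ) + c) - 2 * k - 1) ((c : ℤ) - k + idx p y - p)
  let Dm : Matrix (Fin d) (Fin d) ℚ := Matrix.of fun i j =>
    ibinom (2 * (((j : ℕ) : ℤ) - ((i : ℕ) : ℤ))) (((j : ℕ) : ℤ) - ((i : ℕ) : ℤ))
  have hD : Dm.det = 1 := by
    rw [Matrix.det_of_isUpperTriangular]
    · refine Finset.prod_eq_one fun i _ => ?_
      simp [Dm, ibinom]
    · intro i j hij
      have hij : j < i := hij
      simp only [Dm, Matrix.of_apply]
      exact ibinom_neg _ _ (by have : (j : ℕ) < i := hij; omega)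
  have key : (Qmat (2 * p) b c d p).submatrix (eqv2 p d) (eqv2 p d) =
      Matrix.fromBlocks 1 β 0 1 *
        Matrix.fromBlocks (Smat p ((b : ℤ) + c) c d) 0 Cm Dm := by
    rw [Matrix.fromBlocks_multiply]
    ext x y
    rcases x with x | i <;> rcases y with y | j
    · simp only [Matrix.submatrix_apply, Qmat, Matrix.of_apply, eqv2_inl, idx_lt, if_true,
        Matrix.fromBlocks_apply₁₁, Matrix.one_mul, Matrix.add_apply, Matrix.mul_apply, Smat, β, Cm]
      rw [Finset.sum_range]
      rw [sub_add_cancel]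
      congr 1; ring
    · simp only [Matrix.submatrix_apply, Qmat, Matrix.of_apply, eqv2_inl, eqv2_inr, idx_lt, if_true,
        Matrix.fromBlocks_apply₁₂, Matrix.one_mul, Matrix.add_apply, Matrix.mul_apply, β, Dm]
      rw [if_neg (by omega), B_entry, bet_D d j _ j.2, Finset.sum_range]
      simp
    · simp only [Matrix.submatrix_apply, Qmat, Matrix.of_apply, eqv2_inl, eqv2_inr, idx_lt, if_true,
        Matrix.fromBlocks_apply₂₁, Matrix.one_mul, Matrix.add_apply, Matrix.zero_mul, Cm]
      rw [if_neg (by omega)]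
      simp only [Matrix.zero_apply, zero_add]
      congr 1
      · push_cast; ring
      · push_cast; ring
    · simp only [Matrix.submatrix_apply, Qmat, Matrix.of_apply, eqv2_inr,
        Matrix.fromBlocks_apply₂₂, Matrix.one_mul, Matrix.add_apply, Matrix.zero_mul, Dm]
      rw [if_neg (by omega), if_neg (by omega)]
      simp only [Matrix.zero_apply, zero_add]
      congr 1
      · push_cast; ring
      · push_cast; ring
  unfold E
  rw [← Matrix.det_submatrix_equiv_self (eqv2 p d), key, Matrix.det_mul,
    Matrix.det_fromBlocks_zero₂₁, Matrix.det_fromBlocks_zero₁₂, hD]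
  simp

lemma strictMono_ge {p : ℕ} (f : Fin p → ℕ) (hf : StrictMono f) (i : Fin p) : (i : ℕ) ≤ f i := by
  obtain ⟨i, hi⟩ := i
  induction i with
  | zero => simp
  | succ i ih =>
    have h1 := ih (by omega)
    have h2 : f ⟨i, by omega⟩ < f ⟨i + 1, hi⟩ := hf (by simp [Fin.lt_def])
    simp only at *
    omega

lemma strictMono_le {p q : ℕ} (f : Fin p → ℕ) (hf : StrictMono f) (hq : ∀ i, f i < p + q)
    (i : Fin p) : f i ≤ q + i := by
  have h := strictMono_ge (fun j : Fin p => p + q - 1 - f j.rev) (by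
    intro a b hab
    have h1 : f b.rev < f a.rev := hf (by simpa using hab)
    have := hq a.rev
    simp only
    omega) i.rev
  simp only [Fin.rev_rev, Fin.val_rev] at h
  have := hq i
  have := i.2
  omega

/-- sorted enumeration of an injective function -/
lemma exists_sorted {p : ℕ} (f : Fin p → ℕ) (hf : Function.Injective f) :
    ∃ g : Fin p → ℕ, StrictMono g ∧ (∀ i, ∃ j, g i = f j) ∧
      Finset.univ.image f = Finset.univ.image g := by
  classical
  have hc : (Finset.univ.image f).card = p := by
    rw [Finset.card_image_of_injective _ hf]; simp
  refine ⟨(Finset.univ.image f).orderEmbOfFin hc, (OrderEmbedding.strictMono _), ?_, ?_⟩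
  · intro i
    have := Finset.orderEmbOfFin_mem (Finset.univ.image f) hc i
    obtain ⟨j, -, hj⟩ := Finset.mem_image.1 this
    exact ⟨j, hj.symm⟩
  · simp

lemma sum_le_of_injective {p q : ℕ} (f : Fin p → ℕ) (hf : Function.Injective f)
    (hq : ∀ i, f i < p + q) : ∑ i, f i ≤ ∑ i ∈ range p, (q + i) := by
  classical
  obtain ⟨g, hg, hgf, him⟩ := exists_sorted f hf
  have h1 : ∑ i, f i = ∑ i, g i := by
    rw [← Finset.sum_image (f := fun x => x) (g := f) (fun a _ b _ h => hf h), him,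
      Finset.sum_image (f := fun x => x) (g := g) (fun a _ b _ h => hg.injective h)]
  rw [h1, Finset.sum_range]
  refine Finset.sum_le_sum fun i _ => strictMono_le g hg (fun i => ?_) i
  obtain ⟨j, hj⟩ := hgf i
  rw [hj]; exact hq j

lemma prod_dvd_of_injective {R : Type*} [CommRing R] {p d : ℕ} (Z : R) (f : Fin p → ℕ)
    (hf : Function.Injective f) (hq : ∀ i, f i < p + p) :
    ∏ i ∈ range p, ∏ k ∈ range d, (Z + i - k) ∣
      ∏ r, ∏ m ∈ range (p + d), (Z + f r - m) := by
  classical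
  obtain ⟨g, hg, hgf, him⟩ := exists_sorted f hf
  have h1 : ∏ r, ∏ m ∈ range (p + d), (Z + f r - m) =
      ∏ r, ∏ m ∈ range (p + d), (Z + g r - m) := by
    rw [← Finset.prod_image (f := fun x : ℕ => ∏ m ∈ range (p + d), (Z + x - m)) (g := f)
      (fun a _ b _ h => hf h), him,
      Finset.prod_image (f := fun x : ℕ => ∏ m ∈ range (p + d), (Z + x - m)) (g := g)
      (fun a _ b _ h => hg.injective h)]
  rw [h1, Finset.prod_range]
  refine Finset.prod_dvd_prod_of_dvd _ _ fun i _ => ?_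
  have hlo := strictMono_ge g hg i
  have hhi : g i ≤ p + i := strictMono_le g hg (fun i => by
    obtain ⟨j, hj⟩ := hgf i
    rw [hj]; exact hq j) i
  have h2 : ∏ k ∈ range d, (Z + (i : ℕ) - k) =
      ∏ m ∈ (range d).image (fun k => g i - i + k), (Z + g i - m) := by
    rw [Finset.prod_image (by intro a _ b _ h; simp only at h; omega)]
    refine Finset.prod_congr rfl fun k _ => ?_
    push_cast [Nat.cast_sub hlo]
    ring
  rw [h2]
  refine Finset.prod_dvd_prod_of_subset _ _ _ ?_
  intro m hm
  obtain ⟨k, hk, rfl⟩ := Finset.mem_image.1 hm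
  rw [Finset.mem_range] at *
  omega

open Polynomial

/-- degree bound with integer bounds -/
def DegLe (f : ℚ[X]) (e : ℤ) : Prop := ∀ k : ℕ, e < k → f.coeff k = 0

lemma DegLe.mono {f : ℚ[X]} {e e' : ℤ} (h : DegLe f e) (he : e ≤ e') : DegLe f e' :=
  fun k hk => h k (by omega)

lemma DegLe.mul {f g : ℚ[X]} {e e' : ℤ} (hf : DegLe f e) (hg : DegLe g e') :
    DegLe (f * g) (e + e') := by
  intro k hk
  rw [Polynomial.coeff_mul]
  refine Finset.sum_eq_zero fun x hx => ?_
  have hx := Finset.HasAntidiagonal.mem_antidiagonal.1 hx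
  by_cases h : e < x.1
  · rw [hf _ h, zero_mul]
  · rw [hg x.2 (by omega), mul_zero]

lemma DegLe.zero (e : ℤ) : DegLe 0 e := fun k _ => by simp

lemma DegLe.sum {ι : Type*} (s : Finset ι) (f : ι → ℚ[X]) (e : ℤ) (h : ∀ i ∈ s, DegLe (f i) e) :
    DegLe (∑ i ∈ s, f i) e := by
  intro k hk
  rw [Polynomial.finsetSum_coeff]
  exact Finset.sum_eq_zero fun i hi => h i hi k hk

lemma DegLe.of_natDegree {f : ℚ[X]} {e : ℤ} (h : (f.natDegree : ℤ) ≤ e) : DegLe f e :=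
  fun k hk => Polynomial.coeff_eq_zero_of_natDegree_lt (by omega)

lemma DegLe.prod {ι : Type*} (s : Finset ι) (f : ι → ℚ[X]) (e : ι → ℤ)
    (h : ∀ i ∈ s, DegLe (f i) (e i)) : DegLe (∏ i ∈ s, f i) (∑ i ∈ s, e i) := by
  classical
  induction s using Finset.induction_on with
  | empty => simpa using DegLe.of_natDegree (f := 1) (e := 0) (by simp)
  | insert a s ha ih =>
    rw [Finset.prod_insert ha, Finset.sum_insert ha]
    exact (h a (by simp)).mul (ih fun i hi => h i (by simp [hi]))

lemma DegLe.zsmul {f : ℚ[X]} {e : ℤ} (h : DegLe f e) (u : ℤˣ) : DegLe (u • f) e := by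
  intro k hk
  rcases Int.units_eq_one_or u with rfl | rfl
  · simpa using h k hk
  · simpa using h k hk

/-- forward difference -/
def fd : ℚ[X] →ₗ[ℚ] ℚ[X] := (Polynomial.taylor (1 : ℚ)) - LinearMap.id

lemma fd_degLe {f : ℚ[X]} {e : ℤ} (h : DegLe f e) : DegLe (fd f) (e - 1) := by
  intro k hk
  simp only [fd, LinearMap.sub_apply, LinearMap.id_apply, Polynomial.coeff_sub]
  by_cases hk2 : e < k
  · rw [h k hk2, sub_zero, Polynomial.taylor_coeff]
    have : hasseDeriv k f = 0 := by
      ext j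
      rw [Polynomial.hasseDeriv_coeff, h (j + k) (by push_cast; omega)]; simp
    rw [this]; simp
  · have hke : e = k := by omega
    rw [Polynomial.taylor_coeff]
    have : hasseDeriv k f = C (f.coeff k) := by
      ext j
      rw [Polynomial.hasseDeriv_coeff]
      cases j with
      | zero => simp
      | succ j => rw [h (j + 1 + k) (by push_cast; omega)]; simp
    rw [this]; simp

lemma fd_iter_degLe {f : ℚ[X]} {e : ℤ} (h : DegLe f e) (t : ℕ) :
    DegLe ((fd ^ t) f) (e - t) := by
  induction t with
  | zero => simpa using h
  | succ t ih =>
    rw [pow_succ', Module.End.mul_apply]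
    exact (fd_degLe ih).mono (by push_cast; omega)

lemma shift_eq (f : ℚ[X]) (j M : ℕ) (hj : j < M) :
    f.comp (X + C (j : ℚ)) = ∑ t : Fin M, (fd ^ (t : ℕ)) f * C (j.choose t : ℚ) := by
  have h1 : (Polynomial.taylor (j : ℚ) : ℚ[X] →ₗ[ℚ] ℚ[X]) = (fd + 1) ^ j := by
    have e : (fd + 1 : Module.End ℚ ℚ[X]) = (Polynomial.taylor (1 : ℚ) : ℚ[X] →ₗ[ℚ] ℚ[X]) := by
      refine LinearMap.ext fun f => ?_; simp [fd]
    rw [e]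
    clear hj
    induction j with
    | zero => refine LinearMap.ext fun f => ?_; simp
    | succ j ih =>
      rw [pow_succ, ← ih]
      refine LinearMap.ext fun f => ?_
      rw [Module.End.mul_apply, Polynomial.taylor_taylor]
      push_cast; rfl
  have h2 : f.comp (X + C (j : ℚ)) = (Polynomial.taylor (j : ℚ) : ℚ[X] →ₗ[ℚ] ℚ[X]) f := by
    rw [Polynomial.taylor_apply]
  rw [h2, h1, (Commute.one_right fd).add_pow, LinearMap.sum_apply,
    ← Finset.sum_range (fun t => (fd ^ t) f * C (j.choose t : ℚ)),
    ← Finset.sum_subset (Finset.range_subset_range.2 (show j + 1 ≤ M by omega))]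
  · refine Finset.sum_congr rfl fun t _ => ?_
    simp only [one_pow, mul_one]
    rw [← nsmul_eq_mul', LinearMap.smul_apply]
    rw [nsmul_eq_mul, mul_comm]; simp
  · intro t _ ht
    rw [Nat.choose_eq_zero_of_lt (by simpa using ht)]; simp

/-- the Casorati matrix -/
def Cas {ι : Type*} {M : ℕ} (e : ι ≃ Fin M) (f : ι → ℚ[X]) : Matrix ι ι ℚ[X] :=
  Matrix.of fun i j => (f i).comp (X + C (((e j : Fin M) : ℕ) : ℚ))

lemma cas_degLe {ι : Type*} [Fintype ι] [DecidableEq ι] {M : ℕ} (e : ι ≃ Fin M) (f : ι → ℚ[X])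
    (k : ι → ℤ) (hk : ∀ i, DegLe (f i) (k i)) :
    DegLe (Cas e f).det (∑ i, k i - ∑ t ∈ range M, (t : ℤ)) := by
  have h : Cas e f = (Matrix.of fun i t => (fd ^ ((e t : Fin M) : ℕ)) (f i)) *
      (Matrix.of fun t j => C ((((e j : Fin M) : ℕ).choose (e t : Fin M) : ℕ) : ℚ)) := by
    ext1 i j
    rw [Matrix.mul_apply]
    simp only [Cas, Matrix.of_apply]
    rw [shift_eq _ _ M (e j).2, ← e.sum_comp]
  have hU : (Matrix.of fun t j : ι =>
      (C ((((e j : Fin M) : ℕ).choose (e t : Fin M) : ℕ) : ℚ) : ℚ[X])).det = 1 := by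
    rw [← Matrix.det_submatrix_equiv_self e.symm, Matrix.det_of_isUpperTriangular]
    · simp
    · intro i j hij
      have hij : j < i := hij
      simp [Nat.choose_eq_zero_of_lt hij]
  rw [h, Matrix.det_mul, hU, mul_one, Matrix.det_apply]
  refine DegLe.sum _ _ _ fun σ _ => DegLe.zsmul ?_ _
  have hs : ∑ i, k i - ∑ t ∈ range M, (t : ℤ) = ∑ i, (k (σ i) - ((e i : Fin M) : ℕ)) := by
    rw [Finset.sum_sub_distrib, Equiv.sum_comp σ k, Finset.sum_range,
      e.sum_comp (fun t : Fin M => ((t : ℕ) : ℤ))]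
  rw [hs]
  refine DegLe.prod _ _ _ fun i _ => ?_
  simpa using fd_iter_degLe (hk (σ i)) _

lemma cas_degLe_expand {ι : Type*} [Fintype ι] [DecidableEq ι] {M : ℕ} (e : ι ≃ Fin M)
    (f : ι → ℚ[X]) (h : ℚ) (K : ℕ) (a : ι → ℕ → ℚ)
    (hf : ∀ i, f i = ∑ k ∈ range K, C (a i k) * (X - C h) ^ k) (Bd : ℤ)
    (hB : ∀ κ : ι → ℕ, Function.Injective κ → (∀ i, a i (κ i) ≠ 0) → ∑ i, (κ i : ℤ) ≤ Bd) :
    DegLe (Cas e f).det (Bd - ∑ t ∈ range M, (t : ℤ)) := by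
  classical
  have h1 : (Cas e f).det = ∑ κ ∈ Fintype.piFinset (fun _ : ι => range K),
      (∏ i, C (a i (κ i))) * (Cas e (fun i => (X - C h) ^ (κ i))).det := by
    have h2 : Cas e f = fun i => ∑ k ∈ range K,
        (C (a i k)) • (fun j => ((X - C h) ^ k).comp (X + C (((e j : Fin M) : ℕ) : ℚ))) := by
      funext i j
      rw [Finset.sum_apply]
      simp only [Cas, Matrix.of_apply, Pi.smul_apply, smul_eq_mul]
      rw [hf i, Polynomial.sum_comp]
      simp
    have h3 := (Matrix.detRowAlternating (R := ℚ[X]) (n := ι)).toMultilinearMap.map_sum_finset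
      (fun i k => (C (a i k)) •
        (fun j => ((X - C h) ^ k).comp (X + C (((e j : Fin M) : ℕ) : ℚ)))) (fun _ => range K)
    have h4 : (Cas e f).det = Matrix.detRowAlternating (R := ℚ[X]) (n := ι) (Cas e f) := rfl
    rw [h4, h2]
    refine h3.trans ?_
    refine Finset.sum_congr rfl fun κ _ => ?_
    refine (MultilinearMap.map_smul_univ _ _ _).trans ?_
    rfl
  rw [h1]
  refine DegLe.sum _ _ _ fun κ _ => ?_
  by_cases ha : ∀ i, a i (κ i) ≠ 0
  · by_cases hκ : Function.Injective κ
    · have h5 := (DegLe.prod univ (fun i => (C (a i (κ i)) : ℚ[X])) (fun _ => 0)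
        (fun i _ => DegLe.of_natDegree (by simp))).mul
        (cas_degLe e (fun i => (X - C h) ^ (κ i)) (fun i => (κ i : ℤ))
        (fun i => DegLe.of_natDegree (by simp)))
      refine h5.mono ?_
      have := hB κ hκ ha
      simp only [Finset.sum_const_zero]
      omega
    · have : (Cas e (fun i => (X - C h) ^ (κ i))).det = 0 := by
        unfold Function.Injective at hκ
        push Not at hκ
        obtain ⟨i, j, hij, hne⟩ := hκ
        refine Matrix.det_zero_of_row_eq hne ?_
        ext1 l
        simp [Cas, hij]
      rw [this, mul_zero]
      exact DegLe.zero _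
  · push Not at ha
    obtain ⟨i, hi⟩ := ha
    rw [Finset.prod_eq_zero (Finset.mem_univ i) (by rw [hi]; simp), zero_mul]
    exact DegLe.zero _

lemma center_expand (g : ℚ[X]) (h : ℚ) (K : ℕ) (hK : g.natDegree < K) :
    g = ∑ k ∈ range K, C ((g.comp (X + C h)).coeff k) * (X - C h) ^ k := by
  have h1 : g = (g.comp (X + C h)).comp (X - C h) := by
    rw [Polynomial.comp_assoc]; simp
  have h2 : (g.comp (X + C h)).natDegree < K := by
    rw [Polynomial.natDegree_comp]; simpa using hK
  conv_lhs => rw [h1, Polynomial.as_sum_range' _ K h2, Polynomial.sum_comp]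
  refine Finset.sum_congr rfl fun k _ => ?_
  rw [Polynomial.monomial_comp]

lemma center_parity (g : ℚ[X]) (N ε : ℚ) (hg : g.comp (C N - X) = C ε * g) (k : ℕ)
    (hk : (-1 : ℚ) ^ k ≠ ε) : (g.comp (X + C (N / 2))).coeff k = 0 := by
  set q := g.comp (X + C (N / 2)) with hq
  have h1 : q.comp (C (-1) * X) = C ε * q := by
    have : (C ε * g).comp (X + C (N / 2)) = C ε * q := by simp [hq]
    rw [← this, ← hg, hq, Polynomial.comp_assoc, Polynomial.comp_assoc]
    congr 1
    simp only [add_comp, X_comp, C_comp, sub_comp]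
    have : (C N : ℚ[X]) = C (N / 2) + C (N / 2) := by rw [← C_add]; congr 1; ring
    rw [this]; simp; ring
  have h2 := congrArg (fun r => coeff r k) h1
  simp only [Polynomial.comp_C_mul_X_coeff, Polynomial.coeff_C_mul] at h2
  have h3 : q.coeff k * ((-1) ^ k - ε) = 0 := by rw [mul_sub, h2]; ring
  rcases mul_eq_zero.1 h3 with h | h
  · exact h
  · exact absurd (sub_eq_zero.1 h) hk

lemma cas_row_ops {p M : ℕ} (e : Fin p ⊕ Fin p ≃ Fin M) (f g : Fin p → ℚ[X]) :
    (Cas e (Sum.elim f g)).det =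
      (Cas e (Sum.elim (fun r => f r - g r) (fun r => C (1 / 2) * (f r + g r)))).det := by
  have h : Cas e (Sum.elim (fun r => f r - g r) (fun r => C (1 / 2) * (f r + g r))) =
      Matrix.fromBlocks (1 : Matrix (Fin p) (Fin p) ℚ[X]) 0 (Matrix.diagonal fun _ => C (1 / 2)) 1 *
        (Matrix.fromBlocks (1 : Matrix (Fin p) (Fin p) ℚ[X]) (-1) 0 1 * Cas e (Sum.elim f g)) := by
    have h1 : Matrix.fromBlocks (1 : Matrix (Fin p) (Fin p) ℚ[X]) (-1) 0 1 * Cas e (Sum.elim f g) =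
        Cas e (Sum.elim (fun r => f r - g r) g) := by
      ext1 x y
      rcases x with r | r
      · simp [Matrix.mul_apply, Fintype.sum_sum_type, Cas, Matrix.one_apply, sub_eq_add_neg]
      · simp [Matrix.mul_apply, Fintype.sum_sum_type, Cas, Matrix.one_apply]
    rw [h1]
    ext1 x y
    rcases x with r | r
    · simp [Matrix.mul_apply, Fintype.sum_sum_type, Cas, Matrix.one_apply]
    · simp only [Matrix.mul_apply, Fintype.sum_sum_type, Cas, Matrix.one_apply, Matrix.of_apply,
        Sum.elim_inr, Sum.elim_inl, Matrix.fromBlocks_apply₂₁, Matrix.fromBlocks_apply₂₂,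
        Matrix.diagonal_apply, ite_mul, zero_mul, one_mul, Finset.sum_ite_eq, Finset.mem_univ,
        if_true, mul_comp, add_comp, sub_comp, C_comp]
      have : (C (1 / 2) : ℚ[X]) + C (1 / 2) = 1 := by rw [← C_add]; norm_num
      linear_combination (g r).comp (X + C (((e y : Fin M) : ℕ) : ℚ)) * this
  rw [h, Matrix.det_mul, Matrix.det_mul, Matrix.det_fromBlocks_zero₁₂,
    Matrix.det_fromBlocks_zero₂₁]
  simp

lemma sum_two_mul (p : ℕ) : ∑ t ∈ range (2 * p), (t : ℤ) = 4 * ∑ i ∈ range p, (i : ℤ) + p := by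
  induction p with
  | zero => simp
  | succ p ih =>
    rw [show 2 * (p + 1) = 2 * p + 1 + 1 by ring, Finset.sum_range_succ, Finset.sum_range_succ, ih,
      Finset.sum_range_succ]
    push_cast; ring

lemma cas_degree {p d : ℕ} (e : Fin p ⊕ Fin p ≃ Fin (2 * p)) (g : Fin p → ℚ[X]) (N : ℚ)
    (hg : ∀ r, (g r).natDegree < 2 * p + 2 * d)
    (hg2 : ∀ r, ((g r).comp (C N - X) - g r).natDegree < 2 * p) :
    DegLe (Cas e (Sum.elim (fun r => (g r).comp (C N - X)) g)).det (2 * p * d) := by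
  rw [cas_row_ops]
  have inv : ∀ q : ℚ[X], (q.comp (C N - X)).comp (C N - X) = q := by
    intro q; rw [Polynomial.comp_assoc]; simp
  set F : Fin p ⊕ Fin p → ℚ[X] := Sum.elim (fun r => (g r).comp (C N - X) - g r)
    (fun r => C (1 / 2) * ((g r).comp (C N - X) + g r)) with hF
  have nd : ∀ q : ℚ[X], (q.comp (C N - X)).natDegree = q.natDegree := by
    intro q
    rw [Polynomial.natDegree_comp]
    have : (C N - X : ℚ[X]).natDegree = 1 := by
      rw [← Polynomial.natDegree_neg, neg_sub]; exact natDegree_X_sub_C N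
    rw [this, mul_one]
  have hdeg : ∀ x, (F x).natDegree < 2 * p + 2 * d := by
    intro x
    rcases x with r | r
    · simp only [hF, Sum.elim_inl]
      have := hg2 r
      omega
    · simp only [hF, Sum.elim_inr]
      refine lt_of_le_of_lt (natDegree_C_mul_le _ _) (lt_of_le_of_lt (natDegree_add_le _ _) ?_)
      rw [nd, max_self]; exact hg r
  have hb := cas_degLe_expand e F (N / 2) (2 * p + 2 * d)
    (fun x k => ((F x).comp (X + C (N / 2))).coeff k)
    (fun x => center_expand _ _ _ (hdeg x))
    (2 * p * d + ∑ t ∈ range (2 * p), (t : ℤ)) ?_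
  · refine hb.mono ?_
    simp
  · intro κ hκ ha
    have hodd : ∀ r : Fin p, ∃ k, κ (Sum.inl r) = 2 * k + 1 ∧ k < p + 0 := by
      intro r
      have h1 : Odd (κ (Sum.inl r)) := by
        by_contra hc
        rw [Nat.not_odd_iff_even] at hc
        refine ha (Sum.inl r) (center_parity _ N (-1) ?_ _ ?_)
        · simp only [hF, Sum.elim_inl, sub_comp, inv]
          simp
        · rw [hc.neg_one_pow]; norm_num
      obtain ⟨k, hk⟩ := h1
      refine ⟨k, hk, ?_⟩
      by_contra hc
      refine ha (Sum.inl r) (Polynomial.coeff_eq_zero_of_natDegree_lt ?_)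
      rw [Polynomial.natDegree_comp, Polynomial.natDegree_X_add_C, mul_one]
      have := hg2 r
      simp only [hF, Sum.elim_inl]
      omega
    have heven : ∀ r : Fin p, ∃ k, κ (Sum.inr r) = 2 * k ∧ k < p + d := by
      intro r
      have h1 : Even (κ (Sum.inr r)) := by
        by_contra hc
        rw [Nat.not_even_iff_odd] at hc
        refine ha (Sum.inr r) (center_parity _ N 1 ?_ _ ?_)
        · simp only [hF, Sum.elim_inr, mul_comp, add_comp, inv]
          simp; ring
        · rw [hc.neg_one_pow]; norm_num
      obtain ⟨k, hk⟩ := h1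
      refine ⟨k, by omega, ?_⟩
      by_contra hc
      refine ha (Sum.inr r) (Polynomial.coeff_eq_zero_of_natDegree_lt ?_)
      rw [Polynomial.natDegree_comp, Polynomial.natDegree_X_add_C, mul_one]
      have := hdeg (Sum.inr r)
      omega
    choose u hu hu2 using hodd
    choose v hv hv2 using heven
    have su := sum_le_of_injective u (fun a b hab => by
      have : κ (Sum.inl a) = κ (Sum.inl b) := by rw [hu, hu, hab]
      simpa using hκ this) hu2
    have sv := sum_le_of_injective v (fun a b hab => by
      have : κ (Sum.inr a) = κ (Sum.inr b) := by rw [hv, hv, hab]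
      simpa using hκ this) hv2
    rw [Fintype.sum_sum_type, sum_two_mul]
    simp only [hu, hv]
    push_cast
    rw [Finset.sum_add_distrib, ← Finset.mul_sum, ← Finset.mul_sum]
    zify at su sv
    rw [Finset.sum_add_distrib] at su sv
    simp only [Finset.sum_const, Finset.card_univ, Fintype.card_fin, Finset.card_range,
      nsmul_eq_mul, mul_one, mul_zero, zero_add] at *
    push_cast at *
    linarith

def Tp (N n i i' : ℕ) : ℚ[X] :=
  C ((n.factorial : ℚ) / N.factorial) * (descPochhammer ℚ i *
    (descPochhammer ℚ i').comp (C (N : ℚ) - X))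

lemma choose_aux (k k' i i' : ℕ) : ((k + k').choose k : ℚ) =
    ((k + k' + i + i').choose (i + k) : ℚ) * (((k + k').factorial : ℚ) / (k + k' + i + i').factorial *
      (((i + k).descFactorial i : ℚ) * ((i' + k').descFactorial i' : ℚ))) := by
  have h1 : ((k + k' + i + i').choose (i + k) : ℚ) * (i + k).factorial * (i' + k').factorial =
      (k + k' + i + i').factorial := by
    have := Nat.choose_mul_factorial_mul_factorial (n := k + k' + i + i') (k := i + k) (by omega)
    rw [show k + k' + i + i' - (i + k) = i' + k' by omega] at this
    exact_mod_cast this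
  have h2 : ((k + k').choose k : ℚ) * k.factorial * k'.factorial = (k + k').factorial := by
    have := Nat.choose_mul_factorial_mul_factorial (n := k + k') (k := k) (by omega)
    rw [show k + k' - k = k' by omega] at this
    exact_mod_cast this
  have h3 : (k.factorial : ℚ) * (i + k).descFactorial i = (i + k).factorial := by
    have := Nat.factorial_mul_descFactorial (n := i + k) (k := i) (by omega)
    rw [show i + k - i = k by omega] at this
    exact_mod_cast this
  have h4 : (k'.factorial : ℚ) * (i' + k').descFactorial i' = (i' + k').factorial := by
    have := Nat.factorial_mul_descFactorial (n := i' + k') (k := i') (by omega)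
    rw [show i' + k' - i' = k' by omega] at this
    exact_mod_cast this
  have f1 : (k.factorial : ℚ) ≠ 0 := by exact_mod_cast k.factorial_ne_zero
  have f2 : (k'.factorial : ℚ) ≠ 0 := by exact_mod_cast k'.factorial_ne_zero
  have f3 : ((k + k' + i + i').factorial : ℚ) ≠ 0 := by
    exact_mod_cast (k + k' + i + i').factorial_ne_zero
  rw [← h3, ← h4] at h1
  field_simp
  have h5 : ((k + k').choose k : ℚ) * (k + k' + i + i').factorial * (k.factorial * k'.factorial) =
    ((k + k' + i + i').choose (i + k) : ℚ) * (k + k').factorial * ((i + k).descFactorial i : ℚ) *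
      ((i' + k').descFactorial i' : ℚ) * (k.factorial * k'.factorial) := by
    rw [← h1, ← h2]; ring
  have := mul_right_cancel₀ (mul_ne_zero f1 f2) h5
  linear_combination this

lemma Tp_eval (N n i i' m : ℕ) (hN : N = n + i + i') (hm : m ≤ N) :
    ibinom n ((m : ℤ) - i) = (N.choose m : ℚ) * (Tp N n i i').eval (m : ℚ) := by
  have e : (Tp N n i i').eval (m : ℚ) = (n.factorial : ℚ) / N.factorial *
      ((m.descFactorial i : ℚ) * ((N - m).descFactorial i' : ℚ)) := by
    unfold Tp
    have h1 : (N : ℚ) - m = ((N - m : ℕ) : ℚ) := by rw [Nat.cast_sub hm]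
    simp only [eval_mul, eval_C, eval_comp, eval_sub, eval_X]
    rw [h1, descPochhammer_eval_eq_descFactorial, descPochhammer_eval_eq_descFactorial]
  rw [e]
  by_cases h1 : m < i
  · rw [ibinom_neg _ _ (by omega), Nat.descFactorial_eq_zero_iff_lt.2 h1]; simp
  by_cases h2 : N - m < i'
  · rw [ibinom_gt _ _ (by omega), Nat.descFactorial_eq_zero_iff_lt.2 h2]; simp
  push Not at h1 h2
  obtain ⟨k, rfl⟩ := Nat.exists_eq_add_of_le h1
  obtain ⟨k', hk'⟩ := Nat.exists_eq_add_of_le h2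
  have : n = k + k' := by omega
  subst this
  subst hN
  rw [hk', ← choose_aux k k' i i', ← ibinom_nat]
  congr 1
  push_cast; ring

lemma Tp_comp (N n i i' : ℕ) : (Tp N n i i').comp (C (N : ℚ) - X) = Tp N n i' i := by
  unfold Tp
  simp only [mul_comp, C_comp, comp_assoc, sub_comp, X_comp, sub_sub_cancel, comp_X]
  ring

lemma Tp_natDegree (N n i i' : ℕ) : (Tp N n i i').natDegree ≤ i + i' := by
  unfold Tp
  refine (natDegree_C_mul_le _ _).trans (natDegree_mul_le.trans ?_)
  have : (C (N : ℚ) - X : ℚ[X]).natDegree = 1 := by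
    rw [← Polynomial.natDegree_neg, neg_sub]; exact natDegree_X_sub_C _
  rw [Polynomial.natDegree_comp, this, descPochhammer_natDegree, descPochhammer_natDegree, mul_one]

def Wf (p n N d r : ℕ) : ℚ[X] :=
  Tp N n (p + r) (p - 1 - r) - ∑ k ∈ range d, C (bet r k) * Tp N (n - 2 * k - 1) (p + k) (p + k)

lemma Wf_eval (p n N d r m : ℕ) (hN : N + 1 = n + 2 * p) (hr : r < p) (hd : 2 * d ≤ n)
    (hm : m ≤ N) : (N.choose m : ℚ) * (Wf p n N d r).eval (m : ℚ) =
      ibinom n ((m : ℤ) - p - r) -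
        ∑ k ∈ range d, bet r k * ibinom ((n : ℤ) - 2 * k - 1) ((m : ℤ) - p - k) := by
  unfold Wf
  rw [eval_sub, mul_sub, eval_finsetSum, mul_sum, ← Tp_eval N n (p + r) (p - 1 - r) m (by omega) hm]
  congr 1
  · congr 1; push_cast; ring
  · refine Finset.sum_congr rfl fun k hk => ?_
    have hk := Finset.mem_range.1 hk
    have := Tp_eval N (n - 2 * k - 1) (p + k) (p + k) m (by omega) hm
    rw [eval_mul, eval_C, mul_left_comm, ← this]
    congr 2
    · omega
    · omega

def Fx (p n N d : ℕ) : Fin p ⊕ Fin p → ℚ[X] :=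
  Sum.elim (fun r => (Wf p n N d r).comp (C (N : ℚ) - X)) (fun r => Wf p n N d r)

lemma Fx_eval (p n N d m : ℕ) (x : Fin p ⊕ Fin p) (hN : N + 1 = n + 2 * p) (hd : 2 * d ≤ n)
    (hm : m ≤ N) : (N.choose m : ℚ) * (Fx p n N d x).eval (m : ℚ) =
      ibinom n ((m : ℤ) - idx p x) -
        ∑ k ∈ range d, bet (rr p x) k * ibinom ((n : ℤ) - 2 * k - 1) ((m : ℤ) - p - k) := by
  rcases x with r | r
  · simp only [Fx, Sum.elim_inl, eval_comp, eval_sub, eval_C, eval_X, idx, rr]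
    rw [← Nat.choose_symm hm, ← Nat.cast_sub hm,
      Wf_eval p n N d r (N - m) hN r.2 hd (by omega), ← ibinom_symm]
    have := r.2
    congr 1
    · congr 1; omega
    · refine Finset.sum_congr rfl fun k hk => ?_
      rw [← ibinom_symm]
      congr 2; omega
  · simp only [Fx, Sum.elim_inr, idx, rr]
    rw [Wf_eval p n N d r m hN r.2 hd hm]
    congr 2; push_cast; ring

lemma Smat_det (p n N d c : ℕ) (hN : N + 1 = n + 2 * p) (hd : 2 * d ≤ n) (hc : c ≤ n) :
    (Smat p n c d).det = (∏ j ∈ range (2 * p), (N.choose (c + j) : ℚ)) *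
      (Cas (eqv p) (Fx p n N d)).det.eval (c : ℚ) := by
  have h1 : (Cas (eqv p) (Fx p n N d)).det.eval (c : ℚ) =
      (Matrix.of fun x y => (Fx p n N d x).eval ((c + idx p y : ℕ) : ℚ)).det := by
    rw [← coe_evalRingHom, RingHom.map_det]
    congr 1
    ext x y
    simp [Cas, eqv_val]
  have h2 : ∏ j ∈ range (2 * p), (N.choose (c + j) : ℚ) = ∏ y, (N.choose (c + idx p y) : ℚ) := by
    rw [← Fin.prod_univ_eq_prod_range (fun j => (N.choose (c + j) : ℚ)), ← Equiv.prod_comp (eqv p)]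
    simp only [eqv_val]
  rw [h1, h2, ← Matrix.det_mul_row]
  congr 1
  ext x y
  simp only [Smat, Matrix.of_apply]
  have := idx_lt p y
  rw [Fx_eval p n N d _ x hN hd (by omega)]
  congr 1
  · congr 1; push_cast; ring
  · refine Finset.sum_congr rfl fun k hk => ?_
    congr 2; push_cast; ring

lemma Wf_natDegree (p n N d r : ℕ) (hr : r < p) :
    (Wf p n N d r).natDegree < 2 * p + 2 * d := by
  unfold Wf
  refine lt_of_le_of_lt (natDegree_sub_le _ _) (max_lt ?_ ?_)
  · have := Tp_natDegree N n (p + r) (p - 1 - r); omega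
  · have : (∑ k ∈ range d, C (bet r k) * Tp N (n - 2 * k - 1) (p + k) (p + k)).natDegree ≤
        2 * p + 2 * d - 1 := by
      refine natDegree_sum_le_of_forall_le _ _ fun k hk => ?_
      have hk := Finset.mem_range.1 hk
      have := Tp_natDegree N (n - 2 * k - 1) (p + k) (p + k)
      have := natDegree_C_mul_le (bet r k) (Tp N (n - 2 * k - 1) (p + k) (p + k))
      omega
    omega

lemma Wf_anti (p n N d r : ℕ) (hr : r < p) :
    ((Wf p n N d r).comp (C (N : ℚ) - X) - Wf p n N d r).natDegree < 2 * p := by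
  unfold Wf
  simp only [sub_comp, Polynomial.sum_comp, mul_comp, C_comp, Tp_comp]
  rw [sub_sub_sub_cancel_right]
  refine lt_of_le_of_lt (natDegree_sub_le _ _) (max_lt ?_ ?_)
  · have := Tp_natDegree N n (p - 1 - r) (p + r); omega
  · have := Tp_natDegree N n (p + r) (p - 1 - r); omega

lemma V_degLe (p n N d : ℕ) : DegLe (Cas (eqv p) (Fx p n N d)).det (2 * p * d) :=
  cas_degree (eqv p) (fun r => Wf p n N d r) N (fun r => Wf_natDegree p n N d r r.2)
    (fun r => Wf_anti p n N d r r.2)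

lemma Wf_dvd (p n N d r : ℕ) (hN : N + 1 = n + 2 * p) (hr : r < p) (hd : 2 * d ≤ n) :
    ∏ m ∈ range (p + d), (X - (m : ℚ[X])) ∣ Wf p n N d r := by
  refine Finset.prod_dvd_of_coprime ?_ ?_
  · have := (Polynomial.pairwise_coprime_X_sub_C (K := ℚ) (s := fun m : ℕ => (m : ℚ))
      Nat.cast_injective).set_pairwise (range (p + d) : Set ℕ)
    simpa using this
  · intro m hm
    have hm := Finset.mem_range.1 hm
    have : (X - (m : ℚ[X])) = X - C (m : ℚ) := by simp
    rw [this, dvd_iff_isRoot, IsRoot]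
    have h := Wf_eval p n N d r m hN hr hd (by omega)
    rw [bet_van n d r ((m : ℤ) - p) (by omega) (by omega), sub_self] at h
    have h0 : (N.choose m : ℚ) ≠ 0 := by
      exact_mod_cast (Nat.choose_pos (by omega : m ≤ N)).ne'
    exact (mul_eq_zero.1 h).resolve_left h0

def Gm (p d : ℕ) (Z : ℚ[X]) : ℚ[X] := ∏ i ∈ range p, ∏ k ∈ range d, (Z + i - k)

lemma V_dvd (p n N d : ℕ) (hN : N + 1 = n + 2 * p) (hd : 2 * d ≤ n) :
    Gm p d (C (n : ℚ) - X) * Gm p d X ∣ (Cas (eqv p) (Fx p n N d)).det := by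
  rw [Matrix.det_apply]
  refine Finset.dvd_sum fun σ _ => ?_
  have key : Gm p d (C (n : ℚ) - X) * Gm p d X ∣ ∏ i, Cas (eqv p) (Fx p n N d) (σ i) i := by
    have h0 : ∏ i, Cas (eqv p) (Fx p n N d) (σ i) i =
        ∏ i, Cas (eqv p) (Fx p n N d) i (σ.symm i) := by
      rw [← Equiv.prod_comp σ.symm]; simp
    rw [h0, Fintype.prod_sum_type]
    have inj : Function.Injective fun x => ((eqv p (σ.symm x) : Fin (2 * p)) : ℕ) :=
      Fin.val_injective.comp ((eqv p).injective.comp σ.symm.injective)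
    refine mul_dvd_mul ?_ ?_
    · have h1 := prod_dvd_of_injective (d := d) (C (n : ℚ) - X : ℚ[X])
        (fun r : Fin p => 2 * p - 1 - (eqv p (σ.symm (Sum.inl r)) : Fin (2 * p))) (by
          intro a b hab
          have ha := (eqv p (σ.symm (Sum.inl a))).2
          have hb := (eqv p (σ.symm (Sum.inl b))).2
          have : (Sum.inl a : Fin p ⊕ Fin p) = Sum.inl b := by
            apply inj
            simp only at hab ⊢
            omega
          simpa using this) (fun r => by
            have := r.2
            omega)
      refine h1.trans ?_
      refine Finset.prod_dvd_prod_of_dvd _ _ fun r _ => ?_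
      obtain ⟨q, hq⟩ := Wf_dvd p n N d r hN r.2 hd
      have hj := (eqv p (σ.symm (Sum.inl r))).2
      simp only [Cas, Matrix.of_apply, Fx, Sum.elim_inl]
      generalize ((eqv p (σ.symm (Sum.inl r)) : Fin (2 * p)) : ℕ) = j at hj ⊢
      rw [hq, mul_comp, mul_comp, Polynomial.prod_comp, Polynomial.prod_comp]
      refine Dvd.intro ((q.comp (C (N : ℚ) - X)).comp (X + C (j : ℚ))) ?_
      congr 1
      refine Finset.prod_congr rfl fun m _ => ?_
      have e1 : ((2 * p - 1 - j : ℕ) : ℚ[X]) = C (N : ℚ) - C (n : ℚ) - (j : ℚ[X]) := by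
        have : ((2 * p - 1 - j : ℕ) : ℤ) = N - n - j := by omega
        have h2 := congrArg (fun z : ℤ => (z : ℚ[X])) this
        simpa using h2
      rw [e1]
      simp
      ring
    · have h1 := prod_dvd_of_injective (d := d) (X : ℚ[X])
        (fun r : Fin p => ((eqv p (σ.symm (Sum.inr r)) : Fin (2 * p)) : ℕ)) (by
          intro a b hab
          have : (Sum.inr a : Fin p ⊕ Fin p) = Sum.inr b := inj hab
          simpa using this) (fun r => by
            have := (eqv p (σ.symm (Sum.inr r))).2
            omega)
      refine h1.trans ?_
      refine Finset.prod_dvd_prod_of_dvd _ _ fun r _ => ?_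
      obtain ⟨q, hq⟩ := Wf_dvd p n N d r hN r.2 hd
      simp only [Cas, Matrix.of_apply, Fx, Sum.elim_inr]
      rw [hq, mul_comp, Polynomial.prod_comp]
      refine Dvd.intro (q.comp (X + C (((eqv p (σ.symm (Sum.inr r)) : Fin (2 * p)) : ℕ) : ℚ))) ?_
      congr 1
      refine Finset.prod_congr rfl fun m _ => ?_
      simp
  rcases Int.units_eq_one_or (Equiv.Perm.sign σ) with h | h
  · rw [h]; simpa using key
  · rw [h]; simpa using key

lemma Gm_X_natDegree (p d : ℕ) : (Gm p d X).natDegree = p * d ∧ Gm p d X ≠ 0 := by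
  have h : ∀ i k : ℕ, (X + (i : ℚ[X]) - (k : ℚ[X])) = X - C ((k : ℚ) - i) := by
    intro i k; simp; ring
  have hm : (Gm p d X).Monic := by
    unfold Gm
    refine monic_prod_of_monic _ _ fun i _ => monic_prod_of_monic _ _ fun k _ => ?_
    rw [h]; exact monic_X_sub_C _
  refine ⟨?_, hm.ne_zero⟩
  unfold Gm
  rw [natDegree_prod_of_monic _ _ fun i _ => monic_prod_of_monic _ _ fun k _ => by
    rw [h]; exact monic_X_sub_C _]
  rw [Finset.sum_congr rfl fun i _ => natDegree_prod_of_monic _ _ fun k _ => by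
    rw [h]; exact monic_X_sub_C _]
  simp only [h, natDegree_X_sub_C]
  simp

lemma Gm_comp (p d : ℕ) (Z Y : ℚ[X]) : (Gm p d Z).comp Y = Gm p d (Z.comp Y) := by
  unfold Gm
  simp [Polynomial.prod_comp]

lemma Gm_n_natDegree (p d : ℕ) (n : ℚ) :
    (Gm p d (C n - X)).natDegree = p * d ∧ Gm p d (C n - X) ≠ 0 := by
  have h1 : Gm p d (C n - X) = (Gm p d X).comp (C n - X) := by rw [Gm_comp]; simp
  have hd : (C n - X : ℚ[X]).natDegree = 1 := by
    rw [← Polynomial.natDegree_neg, neg_sub]; exact natDegree_X_sub_C _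
  refine ⟨by rw [h1, natDegree_comp, hd, (Gm_X_natDegree p d).1, mul_one], ?_⟩
  intro h
  have h2 : (Gm p d (C n - X)).comp (C n - X) = Gm p d X := by rw [Gm_comp]; simp
  rw [h, zero_comp] at h2
  exact (Gm_X_natDegree p d).2 h2.symm

lemma V_const (p n N d : ℕ) (hN : N + 1 = n + 2 * p) (hd : 2 * d ≤ n) :
    ∃ κ : ℚ, (Cas (eqv p) (Fx p n N d)).det = Gm p d (C (n : ℚ) - X) * Gm p d X * C κ := by
  obtain ⟨q, hq⟩ := V_dvd p n N d hN hd
  by_cases hq0 : q = 0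
  · exact ⟨0, by rw [hq, hq0]; simp⟩
  have h1 : (Cas (eqv p) (Fx p n N d)).det.natDegree ≤ 2 * p * d := by
    rw [natDegree_le_iff_coeff_eq_zero]
    intro k hk
    exact V_degLe p n N d k (by exact_mod_cast hk)
  obtain ⟨a1, a2⟩ := Gm_n_natDegree p d n
  obtain ⟨b1, b2⟩ := Gm_X_natDegree p d
  have h2 : q.natDegree = 0 := by
    rw [hq, natDegree_mul (mul_ne_zero a2 b2) hq0, natDegree_mul a2 b2, a1, b1] at h1
    nlinarith
  rw [natDegree_eq_zero] at h2
  obtain ⟨κ, rfl⟩ := h2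
  exact ⟨κ, hq⟩

lemma prod_Ioi_eq (p : ℕ) (F : ℕ → ℕ → ℚ) :
    ∏ i : Fin p, ∏ j ∈ Ioi i, F i j = ∏ i ∈ range p, ∏ j ∈ range p, if i < j then F i j else 1 := by
  rw [← Fin.prod_univ_eq_prod_range (fun i => ∏ j ∈ range p, if i < j then F i j else 1)]
  refine Finset.prod_congr rfl fun i _ => ?_
  rw [← Fin.prod_univ_eq_prod_range (fun j => if (i : ℕ) < j then F i j else 1),
    ← Finset.prod_filter]
  refine Finset.prod_congr ?_ fun _ _ => rfl
  ext j; simp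

lemma vand_rev (p : ℕ) (v : ℕ → ℚ) (q : ℕ → ℚ[X]) (hq : ∀ u < p, (q u).natDegree = u)
    (hm : ∀ u < p, (q u).Monic) :
    (Matrix.of fun r t : Fin p => (q (p - 1 - t)).eval (v r)).det =
      ∏ j ∈ range p, ∏ i ∈ range j, (v i - v j) := by
  rw [← Matrix.det_submatrix_equiv_self Fin.revPerm]
  have h1 : (Matrix.of fun r t : Fin p => (q (p - 1 - t)).eval (v r)).submatrix Fin.revPerm
      Fin.revPerm = Matrix.of fun r t : Fin p => (q t).eval (v (p - 1 - r)) := by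
    ext r t
    have hr := r.2
    have ht := t.2
    simp only [Matrix.submatrix_apply, Matrix.of_apply, Fin.revPerm_apply, Fin.val_rev]
    rw [show p - 1 - (p - (t + 1)) = (t : ℕ) by omega, show p - (r + 1) = p - 1 - (r : ℕ) by omega]
  rw [h1, ← Matrix.det_eval_matrixOfPolynomials_eq_det_vandermonde
    (fun r : Fin p => v (p - 1 - r)) (fun t => q t) (fun t => hq t t.2) (fun t => hm t t.2),
    Matrix.det_vandermonde, prod_Ioi_eq p (fun i j => v (p - 1 - j) - v (p - 1 - i)),
    ← Finset.prod_range_reflect]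
  refine Finset.prod_congr rfl fun j hj => ?_
  have hj := Finset.mem_range.1 hj
  rw [← Finset.prod_range_reflect, ← Finset.prod_filter]
  refine Finset.prod_congr ?_ fun i hi => ?_
  · ext i
    simp only [Finset.mem_filter, Finset.mem_range]
    omega
  · have hi := Finset.mem_range.1 hi
    rw [show p - 1 - (p - 1 - i) = i by omega, show p - 1 - (p - 1 - j) = j by omega]

lemma bal_fact (x k : ℕ) : bal (x + 1) k * ((k.factorial : ℚ) * (x + 1 + k).factorial) =
    ((x : ℚ) + 1) * (x + 2 * k).factorial := by
  cases k with
  | zero =>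
    simp only [bal, Nat.factorial]; push_cast; ring_nf
  | succ k =>
    simp only [bal]
    rw [show x + 1 + 2 * k + 1 = x + 2 * k + 2 by ring, show x + 1 + (k + 1) = x + k + 2 by ring,
      show x + 2 * (k + 1) = x + 2 * k + 2 by ring]
    have h1 : ((x + 2 * k + 2).choose (k + 1) : ℚ) * (k + 1).factorial * (x + k + 1).factorial =
        (x + 2 * k + 2).factorial := by
      have := Nat.choose_mul_factorial_mul_factorial (n := x + 2 * k + 2) (k := k + 1) (by omega)
      rw [show x + 2 * k + 2 - (k + 1) = x + k + 1 by omega] at this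
      exact_mod_cast this
    have h2 : ((x + 2 * k + 2).choose k : ℚ) * k.factorial * (x + k + 2).factorial =
        (x + 2 * k + 2).factorial := by
      have := Nat.choose_mul_factorial_mul_factorial (n := x + 2 * k + 2) (k := k) (by omega)
      rw [show x + 2 * k + 2 - k = x + k + 2 by omega] at this
      exact_mod_cast this
    have e1 : ((k + 1).factorial : ℚ) = (k + 1) * k.factorial := by
      rw [Nat.factorial_succ]; push_cast; ring
    have e2 : ((x + k + 2).factorial : ℚ) = (x + k + 2) * (x + k + 1).factorial := by
      rw [Nat.factorial_succ]; push_cast; ring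
    rw [e2] at h2
    rw [e1] at h1
    rw [e1, e2]
    linear_combination ((x : ℚ) + k + 2) * h1 - ((k : ℚ) + 1) * h2

lemma fact_prod (J r u : ℕ) (h : r ≤ J) :
    (((J + u - r).factorial : ℚ) * (J + u + r + 1).factorial) =
      ((J - r).factorial * (J + r + 1).factorial) *
        ∏ i ∈ range u, (-((r : ℚ) * (r + 1)) + ((J : ℚ) + 1 + i) * (J + 2 + i)) := by
  induction u with
  | zero => simp
  | succ u ih =>
    rw [Finset.prod_range_succ, ← mul_assoc, ← ih]
    rw [show J + (u + 1) - r = (J + u - r) + 1 by omega,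
      show J + (u + 1) + r + 1 = (J + u + r + 1) + 1 by ring, Nat.factorial_succ,
      Nat.factorial_succ (J + u + r + 1)]
    have : ((J + u - r : ℕ) : ℚ) = J + u - r := by rw [Nat.cast_sub (by omega)]; push_cast; ring
    push_cast [this]
    ring

lemma bet_fact (J r u : ℕ) (h : r ≤ J + u) :
    bet r J * (((J + u - r).factorial : ℚ) * (J + u + r + 1).factorial) =
      (2 * (r : ℚ) + 1) * (2 * J).factorial *
        ∏ i ∈ range u, (-((r : ℚ) * (r + 1)) + ((J : ℚ) + 1 + i) * (J + 2 + i)) := by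
  by_cases hr : r ≤ J
  · rw [fact_prod J r u hr, ← mul_assoc]
    congr 1
    unfold bet
    rw [if_pos hr]
    have := bal_fact (2 * r) (J - r)
    rw [show 2 * r + 1 + (J - r) = J + r + 1 by omega, show 2 * r + 2 * (J - r) = 2 * J by omega]
      at this
    rw [this]; push_cast; ring
  · unfold bet
    rw [if_neg hr, zero_mul, Finset.prod_eq_zero (i := r - 1 - J) (by simp; omega), mul_zero]
    have : ((r - 1 - J : ℕ) : ℚ) = r - 1 - J := by
      rw [Nat.cast_sub (by omega), Nat.cast_sub (by omega)]; push_cast; ring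
    rw [this]; ring

lemma det_H (p d : ℕ) : (Matrix.of fun r t : Fin p => bet r (d + t)).det =
    (∏ r ∈ range p, ((2 * (r : ℚ) + 1) / ((d + p - 1 - r).factorial * (d + p + r).factorial))) *
    ((∏ t ∈ range p, ((2 * (d + t)).factorial : ℚ)) *
      ∏ j ∈ range p, ∏ i ∈ range j, (((j : ℚ) - i) * (i + j + 1))) := by
  have hv := vand_rev p (fun r => -((r : ℚ) * (r + 1)))
    (fun u => ∏ i ∈ range u, (X + C ((((d + p - 1 - u : ℕ) : ℚ) + 1 + i) *
      (((d + p - 1 - u : ℕ) : ℚ) + 2 + i))))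
    (fun u _ => by
      rw [natDegree_prod_of_monic _ _ fun i _ => monic_X_add_C _]
      simp only [natDegree_X_add_C]; simp)
    (fun u _ => monic_prod_of_monic _ _ fun i _ => monic_X_add_C _)
  have e : ∏ j ∈ range p, ∏ i ∈ range j, (((j : ℚ) - i) * (i + j + 1)) =
      ∏ j ∈ range p, ∏ i ∈ range j, (-((i : ℚ) * (i + 1)) - -((j : ℚ) * (j + 1))) :=
    Finset.prod_congr rfl fun j _ => Finset.prod_congr rfl fun i _ => by ring
  rw [e, ← hv, ← Fin.prod_univ_eq_prod_range (fun t => ((2 * (d + t)).factorial : ℚ)),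
    ← Matrix.det_mul_row, ← Fin.prod_univ_eq_prod_range
      (fun r => ((2 * (r : ℚ) + 1) / ((d + p - 1 - r).factorial * (d + p + r).factorial))),
    ← Matrix.det_mul_column]
  congr 1
  ext r t
  have hr := r.2
  have ht := t.2
  simp only [Matrix.of_apply, eval_prod, eval_add, eval_X, eval_C]
  have h := bet_fact (d + t) r (p - 1 - t) (by omega)
  rw [show d + t + (p - 1 - t) - r = d + p - 1 - r by omega,
    show d + t + (p - 1 - t) + r + 1 = d + p + r by omega] at h
  have f : ((d + p - 1 - r : ℕ).factorial * (d + p + r).factorial : ℚ) ≠ 0 := by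
    exact_mod_cast mul_ne_zero (Nat.factorial_ne_zero _) (Nat.factorial_ne_zero _)
  rw [show d + p - 1 - (p - 1 - (t : ℕ)) = d + t by omega, div_mul_eq_mul_div, eq_div_iff f, h]
  ring

def tau : ℕ → ℕ → ℚ
  | 0, 0 => 1
  | 0, (_ + 1) => 0
  | (k + 1), 0 => tau k 0 + tau k 1
  | (k + 1), (r + 1) => tau k r + 2 * tau k (r + 1) + tau k (r + 2)

lemma tau_gt (k : ℕ) : ∀ r, k < r → tau k r = 0 := by
  induction k with
  | zero => intro r hr; cases r with
    | zero => omega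
    | succ r => rfl
  | succ k ih => intro r hr; cases r with
    | zero => omega
    | succ r =>
      simp only [tau]
      rw [ih r (by omega), ih (r + 1) (by omega), ih (r + 2) (by omega)]; simp

lemma tau_diag (k : ℕ) : tau k k = 1 := by
  induction k with
  | zero => rfl
  | succ k ih =>
    simp only [tau]
    rw [ih, tau_gt k (k + 1) (by omega), tau_gt k (k + 2) (by omega)]; simp

def ar (n : ℕ) (r : ℕ) (M : ℤ) : ℚ := ibinom n (M + r) - ibinom n (M - r - 1)

lemma ar_rec (n r : ℕ) (M : ℤ) :
    ar n (r + 1) (M - 1) + 2 * ar n (r + 1) M + ar n (r + 1) (M + 1) =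
      ar n (r + 2) M + 2 * ar n (r + 1) M + ar n r M := by
  unfold ar
  push_cast
  rw [show M - 1 + (r + 1) = M + r by ring, show M - 1 - (r + 1) - 1 = M - r - 3 by ring,
    show M + 1 + ((r : ℤ) + 1) = M + r + 2 by ring, show M + 1 - ((r : ℤ) + 1) - 1 = M - r - 1 by ring,
    show M + ((r : ℤ) + 2) = M + r + 2 by ring, show M - ((r : ℤ) + 2) - 1 = M - r - 3 by ring]
  ring

lemma ar_rec0 (n : ℕ) (M : ℤ) :
    ar n 0 (M - 1) + 2 * ar n 0 M + ar n 0 (M + 1) = ar n 1 M + ar n 0 M := by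
  unfold ar
  push_cast
  ring_nf

lemma tau_sum_step (n k : ℕ) (M : ℤ) (R : ℕ) :
    ∑ r ∈ range (R + 1), tau k r * (ar n r (M - 1) + 2 * ar n r M + ar n r (M + 1)) =
      ∑ r ∈ range (R + 1), tau (k + 1) r * ar n r M + tau k R * ar n (R + 1) M
        - tau k (R + 1) * ar n R M := by
  induction R with
  | zero =>
    simp only [zero_add, Finset.sum_range_one, ar_rec0, tau]; ring
  | succ R ih =>
    rw [Finset.sum_range_succ, ih, Finset.sum_range_succ _ (R + 1), ar_rec]
    simp only [tau]; ring

def vk (n k : ℕ) (M : ℤ) : ℚ :=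
  ibinom ((n + 2 * k : ℕ) : ℤ) (M + k) - ibinom ((n + 2 * k : ℕ) : ℤ) (M + k - 1)

lemma vk_rec (n k : ℕ) (M : ℤ) : vk n (k + 1) M = vk n k (M - 1) + 2 * vk n k M + vk n k (M + 1) := by
  have h : ∀ j : ℤ, ibinom ((n + 2 * (k + 1) : ℕ) : ℤ) j =
      ibinom ((n + 2 * k : ℕ) : ℤ) j + 2 * ibinom ((n + 2 * k : ℕ) : ℤ) (j - 1) +
        ibinom ((n + 2 * k : ℕ) : ℤ) (j - 2) := by
    intro j
    rw [show ((n + 2 * (k + 1) : ℕ) : ℤ) = ((n + 2 * k : ℕ) : ℤ) + 1 + 1 by push_cast; ring,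
      ibinom_pascal _ _ (by positivity), ibinom_pascal _ _ (by positivity),
      ibinom_pascal _ _ (by positivity), show j - 1 - 1 = j - 2 by ring]
    ring
  unfold vk
  rw [h, h]
  push_cast
  rw [show M + (k + 1) - 2 = M - 1 + k by ring, show M + ((k : ℤ) + 1) - 1 = M + k by ring,
    show M + ((k : ℤ) + 1) = M + 1 + k by ring, show M - 1 + (k : ℤ) = M + k - 1 by ring,
    show M + 1 + (k : ℤ) - 1 = M + k by ring, show M + (k : ℤ) - 2 = M + k - 1 - 1 by ring]
  ring

lemma vk_tau (n k : ℕ) : ∀ (M : ℤ) (R : ℕ), k < R →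
    vk n k M = ∑ r ∈ range (R + 1), tau k r * ar n r M := by
  induction k with
  | zero =>
    intro M R hR
    rw [Finset.sum_range_succ', Finset.sum_eq_zero]
    · simp [tau, vk, ar]
    · intro r _; simp [tau]
  | succ k ih =>
    intro M R hR
    rw [vk_rec, ih _ R (by omega), ih _ R (by omega), ih _ R (by omega)]
    have := tau_sum_step n k M R
    rw [tau_gt k R (by omega), tau_gt k (R + 1) (by omega), zero_mul, zero_mul, add_zero,
      sub_zero] at this
    rw [← this, Finset.mul_sum, ← Finset.sum_add_distrib, ← Finset.sum_add_distrib]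
    refine Finset.sum_congr rfl fun r _ => by ring

lemma det_ar_vk (n p : ℕ) (M : Fin p → ℤ) :
    (Matrix.of fun r l : Fin p => ar n r (M l)).det = (Matrix.of fun k l : Fin p => vk n k (M l)).det := by
  have h : (Matrix.of fun k l : Fin p => vk n k (M l)) =
      (Matrix.of fun k r : Fin p => tau k r) * (Matrix.of fun r l : Fin p => ar n r (M l)) := by
    ext k l
    simp only [Matrix.mul_apply, Matrix.of_apply]
    rw [vk_tau n k _ p k.2, Finset.sum_range_succ, tau_gt _ _ k.2, zero_mul, add_zero,
      Finset.sum_range]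
  rw [h, Matrix.det_mul, Matrix.det_of_isLowerTriangular (Matrix.of fun k r : Fin p => tau k r)]
  · simp [tau_diag]
  · intro i j hij
    have hij : i < j := hij
    exact tau_gt _ _ hij

lemma vk_eval (n N p k m : ℕ) (hN : N + 1 = n + 2 * p) (hk : k < p) (hm : m ≤ N) :
    vk n k ((m : ℤ) - (p - 1)) = ((N : ℚ) - 2 * m) * (N.choose m / N.factorial) *
      ((n + 2 * k).factorial * ∏ s ∈ range (p - 1 - k), ((m : ℚ) * (N - m) - s * (N - s))) := by
  obtain ⟨t, ht⟩ : ∃ t, p = k + 1 + t := Nat.exists_eq_add_of_le hk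
  have h1 := Tp_eval N (n + 2 * k) t (t + 1) m (by omega) hm
  have h2 := Tp_eval N (n + 2 * k) (t + 1) t m (by omega) hm
  unfold vk
  rw [show (m : ℤ) - (p - 1) + k = m - t by omega,
    show (m : ℤ) - t - 1 = m - (t + 1 : ℕ) by push_cast; ring, h1, h2]
  unfold Tp
  simp only [eval_mul, eval_C, eval_comp, eval_sub, eval_X, descPochhammer_succ_eval]
  rw [show p - 1 - k = t by omega]
  have h3 : ∏ s ∈ range t, ((m : ℚ) * (N - m) - s * (N - s)) =
      (descPochhammer ℚ t).eval (m : ℚ) * (descPochhammer ℚ t).eval ((N : ℚ) - m) := by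
    clear h1 h2 ht
    induction t with
    | zero => simp
    | succ t ih =>
      rw [Finset.prod_range_succ, ih, descPochhammer_succ_eval, descPochhammer_succ_eval]; ring
  rw [h3]
  ring

lemma det_Y (p n N d : ℕ) (hN : N + 1 = n + 2 * p) (hd : 2 * d ≤ n) :
    (Matrix.of fun r l : Fin p => ar n r ((d : ℤ) - l)).det =
    (∏ l ∈ range p, (((n : ℚ) - 2 * d + 1 + 2 * l) /
        ((d + p - 1 - l).factorial * (n - d + p + l).factorial))) *
    ((∏ k ∈ range p, ((n + 2 * k).factorial : ℚ)) *
      ∏ j ∈ range p, ∏ i ∈ range j, (((j : ℚ) - i) * ((n : ℚ) - 2 * d + i + j + 1))) := by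
  rw [det_ar_vk]
  have hNq : (N : ℚ) = n + 2 * p - 1 := by
    have := congrArg (fun z : ℕ => (z : ℚ)) hN
    push_cast at this; linarith
  have hv := vand_rev p (fun l => ((d : ℚ) + p - 1 - l) * (N - (d + p - 1 - l)))
    (fun u => ∏ s ∈ range u, (X - C ((s : ℚ) * (N - s))))
    (fun u _ => by
      rw [natDegree_prod_of_monic _ _ fun i _ => monic_X_sub_C _]
      simp only [natDegree_X_sub_C]; simp)
    (fun u _ => monic_prod_of_monic _ _ fun i _ => monic_X_sub_C _)
  have e : ∏ j ∈ range p, ∏ i ∈ range j, (((j : ℚ) - i) * ((n : ℚ) - 2 * d + i + j + 1)) =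
      ∏ j ∈ range p, ∏ i ∈ range j, (((d : ℚ) + p - 1 - i) * (N - (d + p - 1 - i)) -
        ((d : ℚ) + p - 1 - j) * (N - (d + p - 1 - j))) :=
    Finset.prod_congr rfl fun j _ => Finset.prod_congr rfl fun i _ => by rw [hNq]; ring
  rw [e, ← hv, ← Matrix.det_transpose, ← Fin.prod_univ_eq_prod_range
      (fun t => ((n + 2 * t).factorial : ℚ)),
    ← Matrix.det_mul_row, ← Fin.prod_univ_eq_prod_range
      (fun l => (((n : ℚ) - 2 * d + 1 + 2 * l) /
        ((d + p - 1 - l).factorial * (n - d + p + l).factorial))),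
    ← Matrix.det_mul_column]
  congr 1
  ext l k
  have hl := l.2
  have hk := k.2
  simp only [Matrix.of_apply, Matrix.transpose_apply, eval_prod, eval_sub, eval_X, eval_C]
  have h := vk_eval n N p k (d + p - 1 - l) hN hk (by omega)
  have c1 : ((d + p - 1 - l : ℕ) : ℚ) = d + p - 1 - l := by
    rw [Nat.cast_sub (by omega), Nat.cast_sub (by omega)]; push_cast; ring
  rw [c1] at h
  rw [show (d : ℤ) - l = ((d + p - 1 - l : ℕ) : ℤ) - (p - 1) by omega, h]
  congr 1
  have h1 : (N.choose (d + p - 1 - l) : ℚ) * (d + p - 1 - l).factorial * (n - d + p + l).factorial =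
      N.factorial := by
    have := Nat.choose_mul_factorial_mul_factorial (n := N) (k := d + p - 1 - l) (by omega)
    rw [show N - (d + p - 1 - l) = n - d + p + l by omega] at this
    exact_mod_cast this
  have f1 : ((d + p - 1 - l : ℕ).factorial : ℚ) ≠ 0 := by exact_mod_cast Nat.factorial_ne_zero _
  have f2 : ((n - d + p + l : ℕ).factorial : ℚ) ≠ 0 := by exact_mod_cast Nat.factorial_ne_zero _
  have f3 : (N.factorial : ℚ) ≠ 0 := by exact_mod_cast Nat.factorial_ne_zero _
  have f4 : (N.choose (d + p - 1 - l) : ℚ) / N.factorial =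
      1 / ((d + p - 1 - l : ℕ).factorial * (n - d + p + l).factorial) := by
    rw [div_eq_div_iff f3 (mul_ne_zero f1 f2)]; linear_combination h1
  rw [f4, hNq]
  ring

lemma det_U (p d : ℕ) (n : ℤ) : (Matrix.of fun t l : Fin p =>
    if (t : ℕ) ≤ l then gb (n - 2 * d - 1 - 2 * t) (l - t) else 0).det = 1 := by
  rw [Matrix.det_of_isUpperTriangular]
  · simp [gb_zero]
  · intro i j hij
    have hij : j < i := hij
    have : ¬ (i : ℕ) ≤ j := by simpa using hij
    simp [hij]

lemma Smat_base (p n d : ℕ) (hd : 2 * d ≤ n) :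
    (Smat p n d d).det = (Matrix.of fun r l : Fin p => ar n r ((d : ℤ) - l)).det *
      (Matrix.of fun r t : Fin p => bet r (d + t)).det := by
  have key : Smat p n d d = Matrix.fromBlocks (Matrix.of fun r l : Fin p => ar n r ((d : ℤ) - l))
      ((Smat p n d d).toBlocks₁₂) 0 ((Matrix.of fun r t : Fin p => bet r (d + t)) *
        (Matrix.of fun t l : Fin p =>
          if (t : ℕ) ≤ l then gb ((n : ℤ) - 2 * d - 1 - 2 * t) (l - t) else 0)) := by
    ext x y
    rcases x with r | r <;> rcases y with l | l
    · simp only [Smat, Matrix.of_apply, Matrix.fromBlocks_apply₁₁, idx, rr, Sum.elim_inl, ar]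
      have hr := r.2
      have hl := l.2
      congr 1
      · congr 1; omega
      · rw [show (d : ℤ) - l - r - 1 = (d - 1 - l) - r by ring,
          bet_van n d r ((d : ℤ) - 1 - l) (by omega) (by omega)]
        refine Finset.sum_congr rfl fun k _ => ?_
        congr 2; omega
    · simp [Matrix.toBlocks₁₂]
    · simp only [Smat, Matrix.of_apply, Matrix.fromBlocks_apply₂₁, idx, rr, Sum.elim_inl,
        Sum.elim_inr, Matrix.zero_apply]
      have hr := r.2
      have hl := l.2
      have := bet_van n d r ((d : ℤ) - 1 - l) (by omega) (by omega)
      rw [show (d : ℤ) - (p + r : ℕ) + (p - 1 - l : ℕ) = (d - 1 - l) - r by omega, this, sub_eq_zero]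
      refine Finset.sum_congr rfl fun k _ => ?_
      congr 2; omega
    · simp only [Smat, Matrix.of_apply, Matrix.fromBlocks_apply₂₂, idx, rr,
        Sum.elim_inr, Matrix.mul_apply]
      have hl := l.2
      have h := bet_tail n d r l (by omega)
      have e1 : ibinom (n : ℤ) ((d : ℤ) - (p + r : ℕ) + (p + l : ℕ)) =
        ibinom (n : ℤ) (((d + l : ℕ) : ℤ) - r) := by congr 1; push_cast; ring
      have e2 : ∑ k ∈ range d, bet r k * ibinom ((n : ℤ) - 2 * k - 1) ((d : ℤ) - k + (p + l : ℕ) - p) =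
        ∑ k ∈ range d, bet r k * ibinom ((n : ℤ) - 2 * k - 1) (((d + l : ℕ) : ℤ) - k) := by
        refine Finset.sum_congr rfl fun k _ => ?_
        congr 2; push_cast; ring
      rw [e1, e2, h]
      rw [← Finset.sum_range (fun t => bet r (d + t) *
        (if t ≤ (l : ℕ) then gb ((n : ℤ) - 2 * d - 1 - 2 * t) (l - t) else 0))]
      refine (Finset.sum_subset_zero_on_sdiff (s₂ := range p) ?_ ?_ ?_)
      · intro t ht; have := Finset.mem_range.1 ht; exact Finset.mem_range.2 (by omega)
      · intro t ht
        simp only [Finset.mem_sdiff, Finset.mem_range] at ht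
        rw [if_neg (by omega), mul_zero]
      · intro t ht
        have := Finset.mem_range.1 ht
        rw [if_pos (by omega)]
  rw [key, Matrix.det_fromBlocks_zero₂₁, Matrix.det_mul, det_U, mul_one]

lemma fac_ne (n : ℕ) : (n.factorial : ℚ) ≠ 0 := by exact_mod_cast n.factorial_ne_zero

lemma fac_succ (n : ℕ) : ((n + 1).factorial : ℚ) = (n + 1) * n.factorial := by
  rw [Nat.factorial_succ]; push_cast; ring

lemma poch_eq (x : ℚ) (n : ℕ) : poch x n = ∏ i ∈ range n, (x + i) := by
  unfold poch
  induction n with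
  | zero => simp
  | succ n ih => rw [ascPochhammer_succ_eval, ih, Finset.prod_range_succ]

lemma prod_two_mul (p : ℕ) (f : ℕ → ℚ) :
    ∏ i ∈ range (2 * p), f i = ∏ i ∈ range p, (f (2 * i) * f (2 * i + 1)) := by
  induction p with
  | zero => simp
  | succ p ih =>
    rw [show 2 * (p + 1) = 2 * p + 1 + 1 by ring, Finset.prod_range_succ, Finset.prod_range_succ, ih,
      Finset.prod_range_succ]
    ring

lemma fac_A (d x : ℕ) : ∏ k ∈ range d, ((d : ℚ) + x - k) = (d + x).factorial / x.factorial := by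
  rw [eq_div_iff (fac_ne x)]
  induction d with
  | zero => simp
  | succ d ih =>
    rw [Finset.prod_range_succ', show d + 1 + x = d + x + 1 by ring, fac_succ, ← ih]
    have : ∏ k ∈ range d, (((d + 1 : ℕ) : ℚ) + x - ((k + 1 : ℕ) : ℚ)) =
        ∏ k ∈ range d, ((d : ℚ) + x - k) :=
      Finset.prod_congr rfl fun k _ => by push_cast; ring
    rw [this]; push_cast; ring

lemma fac_B (d i : ℕ) : ∏ k ∈ range d, (4 * ((k : ℚ) + 1 / 2 + i)) =
    (2 * (d + i)).factorial * i.factorial / ((2 * i).factorial * (d + i).factorial) := by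
  rw [eq_div_iff (mul_ne_zero (fac_ne _) (fac_ne _))]
  induction d with
  | zero => simp
  | succ d ih =>
    rw [Finset.prod_range_succ, show d + 1 + i = d + i + 1 by ring,
      show 2 * (d + i + 1) = 2 * (d + i) + 1 + 1 by ring, fac_succ, fac_succ, fac_succ]
    push_cast
    linear_combination (4 * ((d : ℚ) + 1 / 2 + i)) * (d + i + 1) * ih

lemma fac_C (d x : ℕ) : ∏ k ∈ range d, ((2 * (d : ℚ) + x - 1 - 2 * k) * (2 * d + x - 2 * k)) =
    (2 * d + x).factorial / x.factorial := by
  rw [eq_div_iff (fac_ne x)]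
  induction d with
  | zero => simp
  | succ d ih =>
    rw [Finset.prod_range_succ', show 2 * (d + 1) + x = 2 * d + x + 1 + 1 by ring, fac_succ, fac_succ,
      ← ih]
    have : ∏ k ∈ range d, ((2 * ((d + 1 : ℕ) : ℚ) + x - 1 - 2 * ((k + 1 : ℕ) : ℚ)) *
          (2 * ((d + 1 : ℕ) : ℚ) + x - 2 * ((k + 1 : ℕ) : ℚ))) =
        ∏ k ∈ range d, ((2 * (d : ℚ) + x - 1 - 2 * k) * (2 * d + x - 2 * k)) :=
      Finset.prod_congr rfl fun k _ => by push_cast; ring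
    rw [this]; push_cast; ring

lemma fac_D (e j : ℕ) : ∏ i ∈ range j, (((j : ℚ) - i) * ((e : ℚ) + i + j + 1)) =
    j.factorial * (e + 2 * j).factorial / (e + j).factorial := by
  rw [Finset.prod_mul_distrib]
  have h1 := fac_A j 0
  simp only [Nat.cast_zero, add_zero, Nat.factorial_zero, Nat.cast_one, div_one] at h1
  have h2 : ∀ x : ℕ, (x.factorial : ℚ) * ∏ i ∈ range j, ((x : ℚ) + 1 + i) = (x + j).factorial := by
    intro x
    clear h1
    induction j with
    | zero => simp
    | succ j ih =>
      rw [Finset.prod_range_succ, ← mul_assoc, ih, ← add_assoc, fac_succ]; push_cast; ring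
  have h3 := h2 (e + j)
  have h4 : ∏ i ∈ range j, ((e : ℚ) + i + j + 1) = ∏ i ∈ range j, (((e + j : ℕ) : ℚ) + 1 + i) :=
    Finset.prod_congr rfl fun k _ => by push_cast; ring
  rw [h1, h4, eq_div_iff (fac_ne _), show e + 2 * j = e + j + j by ring, ← h3]
  ring

lemma fac_refl (d p : ℕ) : ∏ l ∈ range p, ((d + p - 1 - l).factorial : ℚ) =
    ∏ l ∈ range p, ((d + l).factorial : ℚ) := by
  rw [← Finset.prod_range_reflect (fun l => ((d + l).factorial : ℚ))]
  refine Finset.prod_congr rfl fun l hl => ?_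
  have := Finset.mem_range.1 hl
  rw [show d + p - 1 - l = d + (p - 1 - l) by omega]

def gg (p d : ℕ) (x : ℚ) : ℚ := ∏ i ∈ range p, ∏ k ∈ range d, (x + i - k)

def theta (p d : ℕ) (n : ℚ) : ℚ := ∏ k ∈ range d,
  (4 : ℚ) ^ p * poch ((k : ℚ) + 1 / 2) p / (poch (n - 2 * k) (2 * p) * poch ((k : ℚ) + 1) p)

lemma rhs_split (p d : ℕ) (b c : ℚ) :
    ∏ k ∈ Finset.Icc 1 d,
          (4 : ℚ) ^ p * poch (1 + b - k) p * poch (1 + c - k) p *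
              poch ((k : ℚ) - 1 / 2) p /
            (poch (2 + b + c - 2 * k) (2 * p) * poch (k : ℚ) p) =
      gg p d b * gg p d c * theta p d (b + c) := by
  have h0 : Finset.Icc 1 d = Finset.Ico 1 (d + 1) := by ext; simp
  rw [h0, Finset.prod_Ico_eq_prod_range]
  unfold gg theta
  rw [Finset.prod_comm (s := range p), Finset.prod_comm (s := range p), ← Finset.prod_mul_distrib,
    ← Finset.prod_mul_distrib]
  refine Finset.prod_congr (by simp) fun k _ => ?_
  have e1 : ∀ x : ℚ, poch (1 + x - ((1 + k : ℕ) : ℚ)) p = ∏ i ∈ range p, (x + i - k) := by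
    intro x
    rw [poch_eq]
    refine Finset.prod_congr rfl fun i _ => by push_cast; ring
  rw [e1, e1]
  rw [show ((1 + k : ℕ) : ℚ) - 1 / 2 = k + 1 / 2 by push_cast; ring,
    show 2 + b + c - 2 * ((1 + k : ℕ) : ℚ) = b + c - 2 * k by push_cast; ring,
    show ((1 + k : ℕ) : ℚ) = (k : ℚ) + 1 by push_cast; ring]
  ring

lemma gg_theta (p d e : ℕ) : gg p d d * theta p d ((2 * d + e : ℕ) : ℚ) =
    ∏ i ∈ range p, (((2 * (d + i)).factorial * i.factorial / ((2 * i).factorial * (d + i).factorial) : ℚ)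
      / ((2 * d + (e + 2 * i + 1)).factorial / (e + 2 * i + 1).factorial)) := by
  have h1 : ∀ i ∈ range p, (((2 * (d + i)).factorial * i.factorial /
      ((2 * i).factorial * (d + i).factorial) : ℚ)
      / ((2 * d + (e + 2 * i + 1)).factorial / (e + 2 * i + 1).factorial)) =
      (∏ k ∈ range d, (4 * ((k : ℚ) + 1 / 2 + i))) /
        ∏ k ∈ range d, ((((2 * d + e : ℕ) : ℚ) - 2 * k + (2 * i : ℕ)) *
          (((2 * d + e : ℕ) : ℚ) - 2 * k + (2 * i + 1 : ℕ))) := by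
    intro i _
    rw [fac_B, ← fac_C]
    congr 1
    refine Finset.prod_congr rfl fun k _ => ?_
    push_cast; ring
  rw [Finset.prod_congr rfl h1, Finset.prod_div_distrib, Finset.prod_comm (s := range p),
    Finset.prod_comm (s := range p)]
  have h2 : gg p d d = ∏ k ∈ range d, poch ((k : ℚ) + 1) p := by
    unfold gg
    rw [Finset.prod_comm, ← Finset.prod_range_reflect]
    refine Finset.prod_congr rfl fun k hk => ?_
    have hk := Finset.mem_range.1 hk
    rw [poch_eq]
    refine Finset.prod_congr rfl fun i _ => ?_
    rw [Nat.cast_sub (by omega), Nat.cast_sub (by omega)]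
    push_cast; ring
  have h3 : ∏ k ∈ range d, poch ((k : ℚ) + 1) p ≠ 0 := by
    refine Finset.prod_ne_zero_iff.2 fun k _ => ?_
    rw [poch_eq]
    exact Finset.prod_ne_zero_iff.2 fun i _ => by positivity
  unfold theta
  rw [h2, Finset.prod_div_distrib, Finset.prod_mul_distrib (s := range d)
    (f := fun k : ℕ => poch (((2 * d + e : ℕ) : ℚ) - 2 * k) (2 * p))]
  rw [mul_comm (∏ k ∈ range d, poch (((2 * d + e : ℕ) : ℚ) - 2 * k) (2 * p)), mul_div_assoc',
    mul_div_mul_left _ _ h3]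
  congr 1
  · refine Finset.prod_congr rfl fun k _ => ?_
    rw [Finset.prod_mul_distrib, poch_eq]; simp
  · refine Finset.prod_congr rfl fun k _ => ?_
    rw [poch_eq, prod_two_mul]

lemma base_identity (p d e : ℕ) :
    ((∏ l ∈ range p, (((e : ℚ) + 1 + 2 * l) /
        ((d + p - 1 - l).factorial * (d + e + p + l).factorial))) *
    ((∏ k ∈ range p, ((2 * d + e + 2 * k).factorial : ℚ)) *
      ∏ j ∈ range p, ∏ i ∈ range j, (((j : ℚ) - i) * ((e : ℚ) + i + j + 1)))) *
    ((∏ r ∈ range p, ((2 * (r : ℚ) + 1) / ((d + p - 1 - r).factorial * (d + p + r).factorial))) *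
    ((∏ t ∈ range p, ((2 * (d + t)).factorial : ℚ)) *
      ∏ j ∈ range p, ∏ i ∈ range j, (((j : ℚ) - i) * (i + j + 1)))) =
    macmahon (2 * p) (d + e) d * (gg p d (d + e : ℕ) * gg p d d * theta p d ((2 * d + e : ℕ) : ℚ)) := by
  rw [mul_assoc (gg p d _), gg_theta]
  have hg : gg p d (d + e : ℕ) = ∏ i ∈ range p, ((d + (e + i)).factorial / (e + i).factorial : ℚ) := by
    unfold gg
    refine Finset.prod_congr rfl fun i _ => ?_
    rw [← fac_A]
    refine Finset.prod_congr rfl fun k _ => ?_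
    push_cast; ring
  have hD0 : ∏ j ∈ range p, ∏ i ∈ range j, (((j : ℚ) - i) * (i + j + 1)) =
      ∏ j ∈ range p, (j.factorial * (0 + 2 * j).factorial / (0 + j).factorial : ℚ) := by
    refine Finset.prod_congr rfl fun j _ => ?_
    rw [← fac_D]
    refine Finset.prod_congr rfl fun k _ => ?_
    push_cast; ring
  have hm : macmahon (2 * p) (d + e) d = ∏ i ∈ range p,
      (((2 * i).factorial * (2 * d + e + 2 * i).factorial) *
        ((2 * i + 1).factorial * (2 * d + e + (2 * i + 1)).factorial) /
      ((d + e + i).factorial * (d + i).factorial *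
        ((d + e + (p + i)).factorial * (d + (p + i)).factorial)) : ℚ) := by
    unfold macmahon
    rw [Finset.prod_div_distrib, prod_two_mul, two_mul p, Finset.prod_range_add,
      ← Finset.prod_mul_distrib, ← Finset.prod_div_distrib]
    refine Finset.prod_congr rfl fun k _ => ?_
    rw [show d + e + d = 2 * d + e by ring]
  rw [hg, hD0, hm, Finset.prod_congr rfl (fun j _ => fac_D e j)]
  have r1 : ∏ l ∈ range p, (((e : ℚ) + 1 + 2 * l) /
        ((d + p - 1 - l).factorial * (d + e + p + l).factorial)) =
      ∏ l ∈ range p, (((e : ℚ) + 1 + 2 * l) /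
        ((d + l).factorial * (d + e + p + l).factorial)) := by
    rw [Finset.prod_div_distrib, Finset.prod_mul_distrib, fac_refl, ← Finset.prod_mul_distrib,
      ← Finset.prod_div_distrib]
  have r2 : ∏ r ∈ range p, ((2 * (r : ℚ) + 1) / ((d + p - 1 - r).factorial * (d + p + r).factorial)) =
      ∏ r ∈ range p, ((2 * (r : ℚ) + 1) / ((d + r).factorial * (d + p + r).factorial)) := by
    rw [Finset.prod_div_distrib, Finset.prod_mul_distrib, fac_refl, ← Finset.prod_mul_distrib,
      ← Finset.prod_div_distrib]
  rw [r1, r2]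
  simp only [← Finset.prod_mul_distrib]
  refine Finset.prod_congr rfl fun i _ => ?_
  simp only [zero_add]
  rw [show 2 * d + e + (2 * i + 1) = 2 * d + (e + 2 * i + 1) by ring,
    show d + e + (p + i) = d + e + p + i by ring, show d + (p + i) = d + p + i by ring,
    show d + (e + i) = d + e + i by ring, fac_succ (2 * i), fac_succ (e + 2 * i)]
  have := fac_ne
  field_simp [fac_ne]
  push_cast
  ring

lemma mac_eq (p b c N : ℕ) (hN : N + 1 = b + c + 2 * p) :
    macmahon (2 * p) b c = (∏ j ∈ range (2 * p), (N.choose (c + j) : ℚ)) *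
      ∏ i ∈ range (2 * p), ((i.factorial : ℚ) * (b + c + i).factorial / N.factorial) := by
  unfold macmahon
  have h1 : ∏ j ∈ range (2 * p), (N.choose (c + j) : ℚ) =
      (∏ j ∈ range (2 * p), (N.factorial : ℚ)) / ((∏ j ∈ range (2 * p), ((b + j).factorial : ℚ)) *
        ∏ j ∈ range (2 * p), ((c + j).factorial : ℚ)) := by
    rw [← fac_refl, ← Finset.prod_mul_distrib, ← Finset.prod_div_distrib]
    refine Finset.prod_congr rfl fun j hj => ?_
    have hj := Finset.mem_range.1 hj
    rw [eq_div_iff (mul_ne_zero (fac_ne _) (fac_ne _))]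
    have := Nat.choose_mul_factorial_mul_factorial (n := N) (k := c + j) (by omega)
    rw [show N - (c + j) = b + 2 * p - 1 - j by omega] at this
    rw [← this]; push_cast; ring
  rw [h1, Finset.prod_div_distrib, Finset.prod_mul_distrib (f := fun i => ((b + i).factorial : ℚ)),
    Finset.prod_div_distrib]
  have h2 : ∏ j ∈ range (2 * p), (N.factorial : ℚ) ≠ 0 :=
    Finset.prod_ne_zero_iff.2 fun _ _ => fac_ne _
  field_simp

lemma gg_pos (p d x : ℕ) (h : d ≤ x) : gg p d x ≠ 0 := by
  unfold gg
  refine Finset.prod_ne_zero_iff.2 fun i _ => Finset.prod_ne_zero_iff.2 fun k hk => ?_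
  have hk := Finset.mem_range.1 hk
  have : (k : ℚ) + 1 ≤ x := by exact_mod_cast (by omega : k + 1 ≤ x)
  have : (0 : ℚ) ≤ i := by positivity
  exact ne_of_gt (by linarith)

lemma Gm_eval (p d : ℕ) (Z : ℚ[X]) (x : ℚ) : (Gm p d Z).eval x = gg p d (Z.eval x) := by
  unfold Gm gg
  simp [eval_prod]

lemma byun_aux (p b c d : ℕ) (hb : d ≤ b) (hc : d ≤ c) :
    (Smat p ((b + c : ℕ) : ℤ) c d).det = macmahon (2 * p) b c *
      (gg p d b * gg p d c * theta p d ((b + c : ℕ) : ℚ)) := by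
  rcases Nat.eq_zero_or_pos p with rfl | hp
  · simp [macmahon, gg, theta, poch]
  obtain ⟨N, hN⟩ : ∃ N, N + 1 = b + c + 2 * p := ⟨b + c + 2 * p - 1, by omega⟩
  obtain ⟨κ, hκ⟩ := V_const p (b + c) N d hN (by omega)
  have hdet : ∀ c' b' : ℕ, b' + c' = b + c → (Smat p ((b + c : ℕ) : ℤ) c' d).det =
      (∏ j ∈ range (2 * p), (N.choose (c' + j) : ℚ)) * (gg p d b' * gg p d c' * κ) := by
    intro c' b' h
    rw [Smat_det p (b + c) N d c' hN (by omega) (by omega), hκ]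
    simp only [eval_mul, eval_C, Gm_eval, eval_sub, eval_X]
    have : ((b + c : ℕ) : ℚ) - c' = b' := by rw [← h]; push_cast; ring
    rw [this]
  obtain ⟨e, he⟩ : ∃ e, b + c = 2 * d + e := Nat.exists_eq_add_of_le (by omega)
  have h1 := hdet d (d + e) (by omega)
  rw [Smat_base p (b + c) d (by omega), det_Y p (b + c) N d hN (by omega), det_H] at h1
  have hid := base_identity p d e
  have hcast : ((b + c : ℕ) : ℚ) - 2 * d = e := by rw [he]; push_cast; ring
  rw [hcast, show b + c - d = d + e by omega] at h1
  simp only [he] at h1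
  rw [hid, mac_eq p (d + e) d N (by omega), ← he, show d + e + d = b + c by omega] at h1
  have n1 : ∏ j ∈ range (2 * p), (N.choose (d + j) : ℚ) ≠ 0 := by
    refine Finset.prod_ne_zero_iff.2 fun j hj => ?_
    have hj := Finset.mem_range.1 hj
    exact_mod_cast (Nat.choose_pos (by omega : d + j ≤ N)).ne'
  have n2 := gg_pos p d (d + e) (by omega)
  have n3 := gg_pos p d d le_rfl
  have hk : κ = (∏ i ∈ range (2 * p), ((i.factorial : ℚ) * (b + c + i).factorial / N.factorial)) *
      theta p d ((b + c : ℕ) : ℚ) := by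
    refine mul_left_cancel₀ (mul_ne_zero n1 (mul_ne_zero n2 n3)) ?_
    linear_combination -h1
  rw [hdet c b rfl, mac_eq p b c N hN, hk]
  ring

end Helpers

/-- Byun's formula for even intrusions in the case `a = 2p`. -/
theorem byun_even (p b c d : ℕ) (hd : d ≤ min b c) :
    E (2 * p) b c d (p : ℤ) =
      macmahon (2 * p) b c *
        ∏ k ∈ Finset.Icc 1 d,
          (4 : ℚ) ^ p * poch (1 + (b : ℚ) - k) p * poch (1 + (c : ℚ) - k) p *
              poch ((k : ℚ) - 1 / 2) p /
            (poch (2 + (b : ℚ) + c - 2 * k) (2 * p) * poch (k : ℚ) p) := by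
  have hb : d ≤ b := le_trans hd (min_le_left _ _)
  have hc : d ≤ c := le_trans hd (min_le_right _ _)
  have h := byun_aux p b c d hb hc
  have e : ((b + c : ℕ) : ℤ) = (b : ℤ) + c := by push_cast; ring
  rw [E_eq, rhs_split, ← e, h]
  push_cast
  rfl
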